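/- Let p be a prime, set q = p^3, and let B be a minimal blocking set in PG(2,q) that does not contain all the points of any line, with 2·|B| < 3(q+1). Then |B| = p^3 + p^2 + 1 or |B| = p^3 + p^2 + p + 1, and B is of Rédei type: there exists a line l of PG(2,q) with |B ∩ l| = |B| − q. -/

import Mathlib

open Module

open Polynomial

section TotalDegree

variable {R : Type*} [CommRing R]

/-- The bivariate polynomial `f` has total degree at most `n`. -/
def TotDegLE (n : ℕ) (f : R[X][X]) : Prop :=
  ∀ i j, n < i + j → (f.coeff i).coeff j = 0

lemma TotDegLE.mono {m n : ℕ} {f : R[X][X]} (hf : TotDegLE m f) (h : m ≤ n) : TotDegLE n f :=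
  fun i j hij => hf i j (by omega)

lemma TotDegLE.zero (n : ℕ) : TotDegLE n (0 : R[X][X]) := fun i j _ => by simp

lemma TotDegLE.add {n : ℕ} {f g : R[X][X]} (hf : TotDegLE n f) (hg : TotDegLE n g) :
    TotDegLE n (f + g) := fun i j h => by simp [hf i j h, hg i j h]

lemma TotDegLE.sub {n : ℕ} {f g : R[X][X]} (hf : TotDegLE n f) (hg : TotDegLE n g) :
    TotDegLE n (f - g) := fun i j h => by simp [hf i j h, hg i j h]

lemma TotDegLE.neg {n : ℕ} {f : R[X][X]} (hf : TotDegLE n f) :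
    TotDegLE n (-f) := fun i j h => by simp [hf i j h]

lemma TotDegLE.mul {m n : ℕ} {f g : R[X][X]} (hf : TotDegLE m f) (hg : TotDegLE n g) :
    TotDegLE (m + n) (f * g) := by
  intro i j h
  rw [coeff_mul, finsetSum_coeff]
  refine Finset.sum_eq_zero fun a ha => ?_
  rw [coeff_mul]
  refine Finset.sum_eq_zero fun b hb => ?_
  rw [Finset.HasAntidiagonal.mem_antidiagonal] at ha hb
  by_cases h1 : m < a.1 + b.1
  · rw [hf _ _ h1, zero_mul]
  · rw [hg _ _ (by omega), mul_zero]

lemma TotDegLE.prod {ι : Type*} (s : Finset ι) (f : ι → R[X][X]) (h : ∀ i ∈ s, TotDegLE 1 (f i)) :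
    TotDegLE s.card (∏ i ∈ s, f i) := by
  classical
  induction s using Finset.induction_on with
  | empty =>
    intro i j hij
    rw [Finset.prod_empty, coeff_one]
    split_ifs with h0
    · rw [coeff_one, if_neg]
      simp at hij; omega
    · simp
  | insert a s ha ih =>
    rw [Finset.prod_insert ha, Finset.card_insert_of_notMem ha, add_comm]
    exact (h a (Finset.mem_insert_self a s)).mul (ih fun i hi => h i (Finset.mem_insert_of_mem hi))

lemma TotDegLE.linear (a b c : R) :
    TotDegLE 1 (C (C a) * X + C (C b * X + C c) : R[X][X]) := by
  intro i j hij
  rcases i with _ | _ | i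
  · obtain ⟨j, rfl⟩ : ∃ k, j = k + 2 := ⟨j - 2, by omega⟩
    simp [coeff_X, coeff_C]
  · obtain ⟨j, rfl⟩ : ∃ k, j = k + 1 := ⟨j - 1, by omega⟩
    simp [coeff_X, coeff_C]
  · simp

lemma TotDegLE.natDegree_le {n : ℕ} {f : R[X][X]} (hf : TotDegLE n f) : f.natDegree ≤ n := by
  rw [natDegree_le_iff_coeff_eq_zero]
  intro i hi
  ext j
  rw [hf i j (by omega), coeff_zero]

lemma TotDegLE.natDegree_coeff_le {n : ℕ} {f : R[X][X]} (hf : TotDegLE n f) (i : ℕ) :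
    (f.coeff i).natDegree ≤ n - i := by
  rw [natDegree_le_iff_coeff_eq_zero]
  intro j hj
  exact hf i j (by omega)

lemma TotDegLE.derivative {n : ℕ} {f : R[X][X]} (hf : TotDegLE (n + 1) f) :
    TotDegLE n (Polynomial.derivative f) := by
  intro i j hij
  rw [coeff_derivative, ← Nat.cast_succ, ← C_eq_natCast, coeff_mul_C, hf _ _ (by omega), zero_mul]

lemma TotDegLE.exists_div {s : ℕ} {g : R[X][X]} (hg : g.Monic) (hs : g.natDegree = s)
    (hgT : TotDegLE s g) {n : ℕ} {G : R[X][X]} (hG : TotDegLE n G) :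
    ∃ Q U : R[X][X], G = g * Q + U ∧ U.degree < s ∧ TotDegLE n U ∧ TotDegLE (n - s) Q := by
  suffices H : ∀ D : ℕ, ∀ G : R[X][X], TotDegLE n G → G.degree < (s + D : ℕ) →
      ∃ Q U : R[X][X], G = g * Q + U ∧ U.degree < s ∧ TotDegLE n U ∧ TotDegLE (n - s) Q by
    refine H (G.natDegree + 1) G hG ?_
    refine lt_of_le_of_lt degree_le_natDegree ?_
    exact_mod_cast (by omega)
  intro D
  induction D with
  | zero => exact fun G hG h => ⟨0, G, by simp, by simpa using h, hG, TotDegLE.zero _⟩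
  | succ D ih =>
    intro G hG h
    set M : R[X][X] := C (G.coeff (s + D)) * X ^ D with hM
    have hMT : TotDegLE (n - s) M ∧ TotDegLE n (g * M) := by
      by_cases hc : s + D ≤ n
      · have : TotDegLE (n - s) M := by
          intro i j hij
          rw [hM, coeff_C_mul_X_pow]
          split_ifs with hi
          · exact hG _ _ (by omega)
          · simp
        refine ⟨this, ?_⟩
        have := hgT.mul this
        rwa [show s + (n - s) = n by omega] at this
      · have h0 : G.coeff (s + D) = 0 := by
          ext j; exact hG _ _ (by omega)
        have : M = 0 := by simp [hM, h0]
        rw [this, mul_zero]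
        exact ⟨TotDegLE.zero _, TotDegLE.zero _⟩
    obtain ⟨Q, U, h1, h2, h3, h4⟩ := ih (G - g * M) (hG.sub hMT.2) (by
      rw [degree_lt_iff_coeff_zero]
      intro m hm
      rw [hM, coeff_sub]
      rcases hm.eq_or_lt with rfl | hm
      · rw [mul_comm (C _), ← mul_assoc, coeff_mul_C, coeff_mul_X_pow, ← hs,
          hg.coeff_natDegree]
        simp
      · rw [(degree_lt_iff_coeff_zero _ _).1 h m (by omega)]
        rw [mul_comm (C _), ← mul_assoc, coeff_mul_C, coeff_mul_X_pow', if_pos (by omega),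
          coeff_eq_zero_of_natDegree_lt (by omega)]
        simp)
    refine ⟨Q + M, U, ?_, h2, h3, h4.add hMT.1⟩
    rw [mul_add]; linear_combination h1

end TotalDegree

section Univariate

variable {F : Type*} [Field F]

lemma dvd_of_splits_of_forall_pow_dvd {K G : F[X]} (hK : K ≠ 0) (hs : K.Splits)
    (h : ∀ t, (X - C t) ^ K.rootMultiplicity t ∣ G) : K ∣ G := by
  classical
  by_cases hG : G = 0
  · rw [hG]; exact dvd_zero _
  refine hs.dvd_of_roots_le_roots hK ?_
  rw [Multiset.le_iff_count]
  intro t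
  rw [count_roots, count_roots]
  exact (le_rootMultiplicity_iff hG).2 (h t)

lemma rootMultiplicity_prod_linear {ι : Type*} (s : Finset ι) (e g : ι → F)
    (h : ∏ i ∈ s, (C (e i) + C (g i) * X) ≠ 0) [DecidableEq F] (t : F) :
    (∏ i ∈ s, (C (e i) + C (g i) * X)).rootMultiplicity t
      = (s.filter fun i => e i + g i * t = 0).card := by
  classical
  induction s using Finset.induction_on with
  | empty => simp
  | insert a s ha ih =>
    rw [Finset.prod_insert ha] at h ⊢
    rw [rootMultiplicity_mul h, ih (right_ne_zero_of_mul h), Finset.filter_insert]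
    have h1 := left_ne_zero_of_mul h
    split_ifs with h0
    · rw [Finset.card_insert_of_notMem (by simp [ha]), add_comm]
      congr 1
      have : C (e a) + C (g a) * X = C (g a) * (X - C t) := by
        rw [mul_sub, ← C_mul, eq_sub_iff_add_eq, add_right_comm, ← C_add, h0, C_0, zero_add]
      rw [this] at h1 ⊢
      rw [rootMultiplicity_mul h1, rootMultiplicity_C, rootMultiplicity_X_sub_C_self]
    · rw [rootMultiplicity_eq_zero, zero_add]
      simpa [IsRoot] using h0

lemma splits_prod_linear {ι : Type*} (s : Finset ι) (e g : ι → F) :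
    (∏ i ∈ s, (C (e i) + C (g i) * X)).Splits := by
  refine Splits.prod fun i _ => ?_
  refine Splits.of_natDegree_le_one ?_
  rw [add_comm]; exact natDegree_linear_le

lemma pow_rootMultiplicity_dvd_derivative {K : F[X]} {t : F}
    (h : (K.rootMultiplicity t : F) = 0) :
    (X - C t) ^ K.rootMultiplicity t ∣ derivative K := by
  obtain ⟨u, hu⟩ := pow_rootMultiplicity_dvd K t
  set m := K.rootMultiplicity t
  refine ⟨derivative u, ?_⟩
  rw [hu, derivative_mul, derivative_X_sub_C_pow, h]
  simp

lemma derivative_eq_zero_of_dvd {K : F[X]} (h : K ∣ derivative K) : derivative K = 0 := by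
  by_cases h0 : K.natDegree = 0
  · rw [eq_C_of_natDegree_eq_zero h0, derivative_C]
  · by_contra h1
    exact absurd (natDegree_le_of_dvd h h1) (not_le.2 (natDegree_derivative_lt h0))

lemma cast_rootMultiplicity_eq_zero {K : F[X]} (hK : K ≠ 0) (h : derivative K = 0) (t : F) :
    (K.rootMultiplicity t : F) = 0 := by
  obtain ⟨u, hu, hu'⟩ := exists_eq_pow_rootMultiplicity_mul_and_not_dvd K hK t
  set m := K.rootMultiplicity t
  rcases m with _ | m
  · simp
  rw [hu, derivative_mul, derivative_X_sub_C_pow, Nat.add_sub_cancel, pow_succ, mul_assoc,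
    mul_assoc, mul_left_comm, ← mul_add] at h
  have h2 := (mul_eq_zero.1 h).resolve_left (pow_ne_zero _ (X_sub_C_ne_zero t))
  have h3 := congrArg (eval t) h2
  simp only [eval_add, eval_mul, eval_C, eval_sub, eval_X, sub_self, zero_mul, add_zero,
    eval_zero] at h3
  refine (mul_eq_zero.1 h3).resolve_right fun h4 => hu' (dvd_iff_isRoot.2 h4)

variable [Fintype F]

lemma X_pow_card_sub_X_ne_zero' : (X ^ Fintype.card F - X : F[X]) ≠ 0 :=
  FiniteField.X_pow_card_sub_X_ne_zero F Fintype.one_lt_card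

lemma natDegree_X_pow_card_sub_X' : (X ^ Fintype.card F - X : F[X]).natDegree = Fintype.card F :=
  FiniteField.X_pow_card_sub_X_natDegree_eq F Fintype.one_lt_card

lemma eval_X_pow_card_sub_X (t : F) : (X ^ Fintype.card F - X : F[X]).eval t = 0 := by
  simp [FiniteField.pow_card]

lemma rootMultiplicity_X_pow_card_sub_X (t : F) :
    (X ^ Fintype.card F - X : F[X]).rootMultiplicity t = 1 := by
  classical
  rw [← count_roots, FiniteField.roots_X_pow_card_sub_X]
  exact Multiset.count_eq_one_of_mem Finset.univ.nodup (Finset.mem_univ t)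

lemma eq_zero_of_forall_eval_eq_zero {r : F[X]} (hd : r.natDegree < Fintype.card F)
    (h : ∀ x, r.eval x = 0) : r = 0 :=
  eq_zero_of_natDegree_lt_card_of_eval_eq_zero' r Finset.univ (fun x _ => h x) (by simpa using hd)

lemma X_pow_card_sub_X_dvd {r : F[X]} (h : ∀ x, r.eval x = 0) : X ^ Fintype.card F - X ∣ r := by
  refine dvd_of_splits_of_forall_pow_dvd X_pow_card_sub_X_ne_zero' ?_ fun t => ?_
  · rw [splits_iff_card_roots, FiniteField.roots_X_pow_card_sub_X, natDegree_X_pow_card_sub_X']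
    rfl
  · rw [rootMultiplicity_X_pow_card_sub_X, pow_one, dvd_iff_isRoot]
    exact h t

lemma derivative_eq_zero_of_card_eq_one [DecidableEq F] {ι : Type*} (s : Finset ι) (e g : ι → F) (K : F[X])
    (hK : (X ^ Fintype.card F - X) * K = ∏ i ∈ s, (C (e i) + C (g i) * X))
    (h : ∀ t, ((s.filter fun i => e i + g i * t = 0).card : F) = 1) : derivative K = 0 := by
  by_cases hK0 : K = 0
  · simp [hK0]
  have hne := mul_ne_zero (X_pow_card_sub_X_ne_zero' (F := F)) hK0
  refine derivative_eq_zero_of_dvd (dvd_of_splits_of_forall_pow_dvd hK0 ?_ fun t => ?_)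
  · refine Splits.of_dvd (splits_prod_linear s e g) (hK ▸ hne) (hK ▸ dvd_mul_left _ _)
  · refine pow_rootMultiplicity_dvd_derivative ?_
    have h1 := rootMultiplicity_prod_linear s e g (hK ▸ hne) t
    rw [← hK, rootMultiplicity_mul hne, rootMultiplicity_X_pow_card_sub_X] at h1
    have h2 := h t
    rw [← h1] at h2
    simpa using h2

end Univariate

section LinForm

variable {R : Type*} [CommRing R]

/-- The bivariate polynomial `aX + bY + c`, with `Y` the outer variable. -/
noncomputable def linForm (a b c : R) : R[X][X] := C (C b) * X + C (C a * X + C c)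

lemma TotDegLE.linForm (a b c : R) : TotDegLE 1 (linForm a b c) := TotDegLE.linear b a c

lemma evalEval_linForm (a b c x y : R) : (linForm a b c).evalEval x y = a * x + b * y + c := by
  simp [linForm, evalEval]; ring

lemma map_linForm (a b c x : R) :
    (linForm a b c).map (evalRingHom x) = C (a * x + c) + C b * X := by
  simp [linForm]; ring

lemma eval_linForm (a b c y : R) :
    (linForm a b c).eval (C y) = C (b * y + c) + C a * X := by
  simp [linForm]; ring

end LinForm

section Nullstellensatz

variable {F : Type*} [Field F] [Fintype F]

local notation "q" => Fintype.card F

lemma TotDegLE.eq_zero {n : ℕ} {f : F[X][X]} (hf : TotDegLE n f) (hn : n < q)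
    (h : ∀ x y, f.evalEval x y = 0) : f = 0 := by
  have key : ∀ x, f.map (evalRingHom x) = 0 := fun x => by
    refine eq_zero_of_forall_eval_eq_zero ?_ fun y => ?_
    · exact lt_of_le_of_lt (natDegree_map_le.trans hf.natDegree_le) hn
    · rw [map_evalRingHom_eval, h]
  ext1 i
  rw [coeff_zero]
  refine eq_zero_of_forall_eval_eq_zero ?_ fun x => ?_
  · exact lt_of_le_of_lt ((hf.natDegree_coeff_le i).trans (Nat.sub_le _ _)) hn
  · have := congrArg (fun g => coeff g i) (key x)
    simpa using this

lemma totDegLE_of_mul_C {n : ℕ} {g : F[X][X]}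
    (h : TotDegLE n (C (X ^ q - X) * g)) : TotDegLE (n - q) g := by
  intro i j hij
  by_cases hg : g.coeff i = 0
  · rw [hg, coeff_zero]
  have h1 := h.natDegree_coeff_le i
  rw [coeff_C_mul, natDegree_mul X_pow_card_sub_X_ne_zero' hg,
    natDegree_X_pow_card_sub_X'] at h1
  have := Fintype.one_lt_card (α := F)
  exact coeff_eq_zero_of_natDegree_lt (by omega)

lemma monic_X_pow_card_sub_X (R : Type*) [CommRing R] [Nontrivial R] :
    (X ^ q - X : R[X]).Monic ∧ (X ^ q - X : R[X]).natDegree = q := by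
  have h1 := Fintype.one_lt_card (α := F)
  have hd : (X : R[X]).degree < q := by
    rw [degree_X]; exact_mod_cast h1
  refine ⟨(monic_X_pow q).sub_of_left (by rwa [degree_X_pow]), ?_⟩
  rw [natDegree_sub_eq_left_of_natDegree_lt] <;> simp [h1]

lemma exists_eq_of_forall_evalEval_eq_zero {n : ℕ} {H : F[X][X]} (hH : TotDegLE n H)
    (h : ∀ x y, H.evalEval x y = 0) :
    ∃ f g : F[X][X], H = (X ^ q - X) * f + C (X ^ q - X) * g ∧
      TotDegLE (n - q) f ∧ TotDegLE (n - q) g := by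
  obtain ⟨hm, hd⟩ := monic_X_pow_card_sub_X (F := F) F[X]
  have h1 := Fintype.one_lt_card (α := F)
  have hT : TotDegLE q (X ^ q - X : F[X][X]) := by
    intro i j hij
    simp only [coeff_sub, coeff_X_pow, coeff_X]
    split_ifs <;> simp [coeff_one] <;> omega
  obtain ⟨f, U, e, hU, hUT, hf⟩ := TotDegLE.exists_div hm hd hT hH
  have hU0 : ∀ x, U.map (evalRingHom x) = 0 := fun x => by
    refine eq_zero_of_forall_eval_eq_zero ?_ fun y => ?_
    · by_cases hU0 : U = 0
      · simp [hU0]; omega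
      · exact lt_of_le_of_lt natDegree_map_le ((natDegree_lt_iff_degree_lt hU0).2 hU)
    · have := h x y
      rw [e] at this
      rw [map_evalRingHom_eval]
      simpa [FiniteField.pow_card] using this
  have hdiv : ∀ i, (X ^ q - X : F[X]) ∣ U.coeff i := fun i => X_pow_card_sub_X_dvd fun x => by
    have := congrArg (fun g => coeff g i) (hU0 x)
    simpa using this
  obtain ⟨g, hg⟩ := (C_dvd_iff_dvd_coeff _ _).2 hdiv
  refine ⟨f, g, by rw [e, hg], hf, totDegLE_of_mul_C (hg ▸ hUT)⟩

end Nullstellensatz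

section ProdLinForm

variable {F : Type*} [Field F]

lemma map_prod_linForm {ι : Type*} (s : Finset ι) (a b c : ι → F) (x : F) :
    (∏ i ∈ s, linForm (a i) (b i) (c i)).map (evalRingHom x)
      = ∏ i ∈ s, (C (a i * x + c i) + C (b i) * X) := by
  rw [Polynomial.map_prod]
  exact Finset.prod_congr rfl fun i _ => map_linForm _ _ _ _

lemma eval_prod_linForm {ι : Type*} (s : Finset ι) (a b c : ι → F) (y : F) :
    (∏ i ∈ s, linForm (a i) (b i) (c i)).eval (C y)
      = ∏ i ∈ s, (C (b i * y + c i) + C (a i) * X) := by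
  rw [eval_prod]
  exact Finset.prod_congr rfl fun i _ => eval_linForm _ _ _ _

lemma evalEval_prod_linForm_eq_zero {ι : Type*} (s : Finset ι) (a b c : ι → F) (x y : F)
    (h : ∃ i ∈ s, a i * x + b i * y + c i = 0) :
    (∏ i ∈ s, linForm (a i) (b i) (c i)).evalEval x y = 0 := by
  obtain ⟨i, hi, h0⟩ := h
  rw [evalEval_prod]
  exact Finset.prod_eq_zero hi (by rw [evalEval_linForm, h0])

lemma linForm_one (a c : F) : linForm a 1 c = X + C (C a * X + C c) := by
  simp [linForm]

end ProdLinForm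

section OneModP

variable {F : Type*} [Field F] [Fintype F] [DecidableEq F]

local notation "q" => Fintype.card F

/-- Vanishing of a product at a point with two vanishing factors is of order at least two. -/
lemma eval_eq_zero_of_two_le_card {ι : Type*} (s : Finset ι) (e g : ι → F) (K : F[X])
    (hK : (X ^ q - X) * K = ∏ i ∈ s, (C (e i) + C (g i) * X)) {t : F}
    (h : 2 ≤ (s.filter fun i => e i + g i * t = 0).card) : K.eval t = 0 := by
  by_cases hK0 : K = 0
  · simp [hK0]
  have hne := mul_ne_zero (X_pow_card_sub_X_ne_zero' (F := F)) hK0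
  have h1 := rootMultiplicity_prod_linear s e g (hK ▸ hne) t
  rw [← hK, rootMultiplicity_mul hne, rootMultiplicity_X_pow_card_sub_X] at h1
  exact (rootMultiplicity_pos hK0).1 (by omega)

lemma card_filter_eq_one_of_tangents {ι : Type*} (s : Finset ι) (a c : ι → F) (k : ℕ)
    (hs : s.card = q + k) (hk : 2 * k ≤ q)
    (hcov : ∀ x y, ∃ i ∈ s, a i * x + 1 * y + c i = 0)
    (htan : ∀ i ∈ s, ∃ x y, a i * x + 1 * y + c i = 0 ∧
      ∀ j ∈ s, a j * x + 1 * y + c j = 0 → j = i) (x y : F) :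
    ((s.filter fun i => a i * x + 1 * y + c i = 0).card : F) = 1 := by
  have hq := Fintype.one_lt_card (α := F)
  set H : F[X][X] := ∏ i ∈ s, linForm (a i) 1 (c i) with hH
  have hHT : TotDegLE (q + k) H := hs ▸ TotDegLE.prod s _ fun i _ => TotDegLE.linForm _ _ _
  have hHm : H.Monic := monic_prod_of_monic _ _ fun i _ => by
    rw [linForm_one]; exact monic_X_add_C _
  have hHd : H.natDegree = q + k := by
    rw [hH, natDegree_prod_of_monic _ _ fun i _ => by rw [linForm_one]; exact monic_X_add_C _]
    rw [Finset.sum_congr rfl fun i _ => by rw [linForm_one, natDegree_X_add_C]]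
    simp [hs]
  obtain ⟨f, g, e, hf, hg⟩ := exists_eq_of_forall_evalEval_eq_zero hHT fun x y =>
    evalEval_prod_linForm_eq_zero s a (fun _ => 1) c x y (hcov x y)
  rw [Nat.add_sub_cancel_left] at hf hg
  have hfk : f.coeff k = 1 := by
    have h1 : H.coeff (q + k) = 1 := by rw [← hHd]; exact hHm
    have h2 : f.coeff (k + q - 1) = 0 :=
      coeff_eq_zero_of_natDegree_lt (lt_of_le_of_lt hf.natDegree_le (by omega))
    have h3 : g.coeff (k + q) = 0 :=
      coeff_eq_zero_of_natDegree_lt (lt_of_le_of_lt hg.natDegree_le (by omega))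
    rw [e, coeff_add, coeff_C_mul, sub_mul, coeff_sub, add_comm q k, coeff_X_pow_mul,
      show k + q = (k + q - 1) + 1 by omega, coeff_X_mul, h2, Nat.sub_add_cancel (by omega), h3] at h1
    simpa using h1
  have hfm : f.Monic := monic_of_natDegree_le_of_coeff_eq_one k hf.natDegree_le hfk
  have hfd : f.natDegree = k :=
    natDegree_eq_of_le_of_coeff_ne_zero hf.natDegree_le (by rw [hfk]; exact one_ne_zero)
  -- restriction to a vertical line
  have hmapx : ∀ x, (X ^ q - X) * f.map (evalRingHom x) =
      ∏ i ∈ s, (C (a i * x + c i) + C 1 * X) := fun x => by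
    rw [← map_prod_linForm s a (fun _ => 1) c x, ← hH, e]
    rw [Polynomial.map_add, Polynomial.map_mul, Polynomial.map_mul, map_C, coe_evalRingHom,
      eval_X_pow_card_sub_X]
    simp
  have hmapy : ∀ y, (X ^ q - X) * g.eval (C y) =
      ∏ i ∈ s, (C (1 * y + c i) + C (a i) * X) := fun y => by
    rw [← eval_prod_linForm s a (fun _ => 1) c y, ← hH, e]
    rw [eval_add, eval_mul, eval_mul, eval_C, eval_sub, eval_pow, eval_X, ← C_pow,
      FiniteField.pow_card]
    simp
  have hfx0 : ∀ x, f.map (evalRingHom x) ≠ 0 := fun x => (hfm.map _).ne_zero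
  have hcount : ∀ x y, 1 + (f.map (evalRingHom x)).rootMultiplicity y =
      (s.filter fun i => a i * x + 1 * y + c i = 0).card := fun x y => by
    have hne := mul_ne_zero (X_pow_card_sub_X_ne_zero' (F := F)) (hfx0 x)
    have h1 := rootMultiplicity_prod_linear s (fun i => a i * x + c i) (fun _ => 1)
      (hmapx x ▸ hne) y
    rw [← hmapx x, rootMultiplicity_mul hne, rootMultiplicity_X_pow_card_sub_X] at h1
    rw [h1]
    congr 1
    exact Finset.filter_congr fun i _ => by rw [add_right_comm]
  have htwo : ∀ x y, f.evalEval x y = 0 →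
      2 ≤ (s.filter fun i => a i * x + 1 * y + c i = 0).card := fun x y h => by
    rw [← hcount]
    rw [← map_evalRingHom_eval] at h
    have := (rootMultiplicity_pos (hfx0 x)).2 h
    omega
  have hgz : ∀ x y, f.evalEval x y = 0 → g.evalEval x y = 0 := fun x y h => by
    refine eval_eq_zero_of_two_le_card s _ _ _ (hmapy y) ?_
    convert htwo x y h using 4
    ring
  have hsplit : ∀ x, (f.map (evalRingHom x)).Splits := fun x => by
    refine Splits.of_dvd (splits_prod_linear s _ _) ?_ ((hmapx x) ▸ dvd_mul_left _ _)
    rw [← hmapx x]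
    exact mul_ne_zero (X_pow_card_sub_X_ne_zero' (F := F)) (hfx0 x)
  have hdvdx : ∀ x, f.map (evalRingHom x) ∣ (derivative f * g).map (evalRingHom x) := fun x => by
    refine dvd_of_splits_of_forall_pow_dvd (hfx0 x) (hsplit x) fun t => ?_
    set m := (f.map (evalRingHom x)).rootMultiplicity t with hm
    rcases Nat.eq_zero_or_pos m with h0 | h0
    · rw [h0, pow_zero]; exact one_dvd _
    rw [Polynomial.map_mul, ← derivative_map, ← Nat.sub_add_cancel h0, pow_succ]
    refine mul_dvd_mul ?_ ?_
    · exact pow_sub_one_dvd_derivative_of_pow_dvd (pow_rootMultiplicity_dvd _ _)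
    · rw [dvd_iff_isRoot, IsRoot, map_evalRingHom_eval]
      refine hgz x t ?_
      rw [← map_evalRingHom_eval]
      exact (rootMultiplicity_pos (hfx0 x)).1 h0
  have hdvd : f ∣ derivative f * g := by
    rcases Nat.eq_zero_or_pos k with h0 | h0
    · rw [eq_one_of_monic_natDegree_zero hfm (hfd.trans h0)]; exact one_dvd _
    obtain ⟨k', rfl⟩ : ∃ k', k = k' + 1 := ⟨k - 1, by omega⟩
    obtain ⟨Q, U, h1, h2, h3, -⟩ := TotDegLE.exists_div hfm hfd hf (hf.derivative.mul hg)
    suffices U = 0 by rw [h1, this, add_zero]; exact dvd_mul_right _ _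
    refine h3.eq_zero (by omega) fun x y => ?_
    have h4 : f.map (evalRingHom x) ∣ U.map (evalRingHom x) := by
      have := hdvdx x
      rw [h1, Polynomial.map_add, Polynomial.map_mul] at this
      exact (dvd_add_right (dvd_mul_right _ _)).1 this
    rw [← map_evalRingHom_eval]
    suffices U.map (evalRingHom x) = 0 by rw [this, eval_zero]
    refine eq_zero_of_dvd_of_degree_lt h4 ?_
    rw [hfm.degree_map, degree_eq_natDegree hfm.ne_zero, hfd]
    exact lt_of_le_of_lt degree_map_le h2
  have hrel : f ∣ derivative f := by
    refine UniqueFactorizationMonoid.dvd_of_dvd_mul_left_of_no_prime_factors hfm.ne_zero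
      (fun d hdf hdg hd => ?_) hdvd
    have hdH : d ∣ H := by rw [e]; exact dvd_add (hdf.mul_left _) (hdg.mul_left _)
    obtain ⟨i, hi, hdi⟩ := (Prime.dvd_finsetProd_iff hd _).1 hdH
    have hirr : Irreducible (linForm (a i) 1 (c i)) := by
      rw [linForm_one]
      exact Monic.irreducible_of_degree_eq_one (degree_X_add_C _) (monic_X_add_C _)
    have hif : linForm (a i) 1 (c i) ∣ f :=
      ((hirr.dvd_iff.1 hdi).resolve_left hd.not_isUnit).dvd.trans hdf
    obtain ⟨x, y, hxy, hj⟩ := htan i hi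
    have h2 := htwo x y (zero_dvd_iff.1 (by
      have := evalEval_dvd x y hif
      rwa [evalEval_linForm, hxy] at this))
    obtain ⟨j, hj1, hj2⟩ := Finset.exists_mem_ne (Nat.lt_of_succ_le h2) i
    rw [Finset.mem_filter] at hj1
    exact hj2 (hj j hj1.1 hj1.2)
  have hf0 : derivative f = 0 := by
    rcases Nat.eq_zero_or_pos k with h0 | h0
    · rw [eq_one_of_monic_natDegree_zero hfm (hfd.trans h0)]; simp
    by_contra h1
    have := natDegree_le_of_dvd hrel h1
    exact absurd this (not_le.2 (natDegree_derivative_lt (by omega)))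
  rw [← hcount, Nat.cast_add, cast_rootMultiplicity_eq_zero (hfx0 x)
    (by rw [derivative_map, hf0, Polynomial.map_zero]) y]
  simp

end OneModP

section Frames

variable {F : Type*} [Field F]

/-- Three vectors forming a basis of `F³`, phrased with explicit coordinates. -/
structure IsFrame (u v w : Fin 3 → F) : Prop where
  span : ∀ t, ∃ a b c : F, t = a • u + b • v + c • w
  indep : ∀ a b c : F, a • u + b • v + c • w = 0 → a = 0 ∧ b = 0 ∧ c = 0

lemma IsFrame.eq_zero {u v w T : Fin 3 → F} (h : IsFrame u v w) (h1 : T ⬝ᵥ u = 0)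
    (h2 : T ⬝ᵥ v = 0) (h3 : T ⬝ᵥ w = 0) : T = 0 := by
  rw [← dotProduct_eq_zero_iff]
  intro t
  obtain ⟨a, b, c, rfl⟩ := h.span t
  simp [dotProduct_add, h1, h2, h3]

lemma exists_isFrame {u T : Fin 3 → F} (hu : u ≠ 0) (hT : T ≠ 0) (h : T ⬝ᵥ u = 0) :
    ∃ v w, T ⬝ᵥ v = 0 ∧ T ⬝ᵥ w = 1 ∧ IsFrame u v w := by
  classical
  obtain ⟨k, hk⟩ : ∃ k, T k ≠ 0 := by
    by_contra! h0; exact hT (funext h0)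
  let f : (Fin 3 → F) →ₗ[F] F := dotProductBilin F F T
  have hf : ∀ x, f x = T ⬝ᵥ x := fun x => rfl
  set w : Fin 3 → F := Pi.single k (T k)⁻¹ with hw
  have hTw : T ⬝ᵥ w = 1 := by rw [hw, dotProduct_single, mul_inv_cancel₀ hk]
  have hrank : finrank F (LinearMap.ker f) = 2 := by
    have h1 := LinearMap.finrank_range_add_finrank_ker f
    have h2 : LinearMap.range f = ⊤ := by
      rw [LinearMap.range_eq_top]
      intro x; exact ⟨x • w, by rw [hf, dotProduct_smul, hTw, smul_eq_mul, mul_one]⟩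
    rw [h2, finrank_top, finrank_self, finrank_fin_fun] at h1
    omega
  obtain ⟨v, hv, hvu⟩ : ∃ v, T ⬝ᵥ v = 0 ∧ v ∉ Submodule.span F {u} := by
    by_contra! h0
    have : LinearMap.ker f ≤ Submodule.span F {u} := fun v hv => h0 v hv
    have := Submodule.finrank_mono this
    rw [hrank, finrank_span_singleton hu] at this
    omega
  have hind : ∀ a b c : F, a • u + b • v + c • w = 0 → a = 0 ∧ b = 0 ∧ c = 0 := by
    intro a b c h0
    have hc : c = 0 := by
      have := congrArg (T ⬝ᵥ ·) h0
      simpa [dotProduct_add, h, hv, hTw] using this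
    rw [hc, zero_smul, add_zero] at h0
    have hb : b = 0 := by
      by_contra hb
      refine hvu (Submodule.mem_span_singleton.2 ⟨-(b⁻¹ * a), ?_⟩)
      have : b • v = (-a) • u := by rw [neg_smul, eq_neg_iff_add_eq_zero, add_comm, h0]
      rw [← inv_smul_smul₀ hb v, this, smul_smul, mul_neg]
    rw [hb, zero_smul, add_zero] at h0
    exact ⟨(smul_eq_zero.1 h0).resolve_right hu, hb, hc⟩
  refine ⟨v, w, hv, hTw, ?_, hind⟩
  have hli : LinearIndependent F ![u, v, w] := by
    rw [Fintype.linearIndependent_iff]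
    intro g hg
    rw [Fin.sum_univ_three] at hg
    obtain ⟨h1, h2, h3⟩ := hind _ _ _ hg
    intro i; fin_cases i <;> assumption
  have htop := hli.span_eq_top_of_card_eq_finrank (by simp)
  intro t
  have ht : t ∈ Submodule.span F (Set.range ![u, v, w]) := htop ▸ Submodule.mem_top
  obtain ⟨c, hc⟩ := (Submodule.mem_span_range_iff_exists_fun F).1 ht
  rw [Fin.sum_univ_three] at hc
  exact ⟨c 0, c 1, c 2, hc.symm⟩

lemma eq_smul_of_isFrame {u v w T P : Fin 3 → F} (h : IsFrame u v w) (h1 : T ⬝ᵥ u = 0)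
    (h2 : T ⬝ᵥ v = 0) (h3 : T ⬝ᵥ w = 1) (hu : P ⬝ᵥ u = 0) (hv : P ⬝ᵥ v = 0) :
    P = (P ⬝ᵥ w) • T := by
  rw [← sub_eq_zero]
  refine h.eq_zero ?_ ?_ ?_ <;> simp [sub_dotProduct, h1, h2, h3, hu, hv]

end Frames

section Config

variable {F : Type*} [Field F] [Fintype F] [DecidableEq F] {ι : Type*}

local notation "q" => Fintype.card F

/-- The points spanned by the vectors `r i`, `i ∈ S`, form a small minimal blocking set of the
projective plane that contains no line; lines are given by their dual coordinate vectors. -/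
structure SmallBlocking (S : Finset ι) (r : ι → Fin 3 → F) : Prop where
  ne_zero : ∀ i ∈ S, r i ≠ 0
  eq_of_smul : ∀ i ∈ S, ∀ j ∈ S, ∀ c : F, r i = c • r j → i = j
  block : ∀ u : Fin 3 → F, u ≠ 0 → ∃ i ∈ S, r i ⬝ᵥ u = 0
  tangent : ∀ i ∈ S, ∃ u : Fin 3 → F, u ≠ 0 ∧ r i ⬝ᵥ u = 0 ∧ ∀ j ∈ S, r j ⬝ᵥ u = 0 → j = i
  noline : ∀ u : Fin 3 → F, u ≠ 0 → ∃ T : Fin 3 → F, T ≠ 0 ∧ T ⬝ᵥ u = 0 ∧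
    ∀ i ∈ S, ∀ c : F, r i ≠ c • T
  small : 2 * S.card < 3 * (q + 1)

/-- The number of points on the line with dual coordinates `u`. -/
def lineCard (S : Finset ι) (r : ι → Fin 3 → F) (u : Fin 3 → F) : ℕ :=
  (S.filter fun i => r i ⬝ᵥ u = 0).card

variable {S : Finset ι} {r : ι → Fin 3 → F}

lemma lineCard_eq_one {i : ι} (hi : i ∈ S) {u : Fin 3 → F} (hu : r i ⬝ᵥ u = 0)
    (h : ∀ j ∈ S, r j ⬝ᵥ u = 0 → j = i) : lineCard S r u = 1 := by
  rw [lineCard, Finset.card_eq_one]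
  refine ⟨i, Finset.eq_singleton_iff_unique_mem.2 ⟨by simp [hi, hu], fun j hj => ?_⟩⟩
  rw [Finset.mem_filter] at hj
  exact h j hj.1 hj.2

lemma SmallBlocking.lineCard_add_le (hB : SmallBlocking S r) {u : Fin 3 → F} (hu : u ≠ 0) :
    lineCard S r u + q ≤ S.card := by
  obtain ⟨T, hT, hTu, hTS⟩ := hB.noline u hu
  obtain ⟨v, w, hv, hw, hfr⟩ := exists_isFrame hu hT hTu
  have hne : ∀ m : F, m • u + v ≠ 0 := fun m h0 =>
    one_ne_zero (hfr.indep m 1 0 (by simpa using h0)).2.1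
  choose f hf hf0 using fun m : F => hB.block (m • u + v) (hne m)
  have hfu : ∀ m, r (f m) ⬝ᵥ u ≠ 0 := fun m h0 => by
    have h1 := hf0 m
    rw [dotProduct_add, dotProduct_smul, h0, smul_zero, zero_add] at h1
    exact hTS _ (hf m) _ (eq_smul_of_isFrame hfr hTu hv hw h0 h1)
  have hinj : Function.Injective f := fun m m' hmm => by
    have h1 := hf0 m
    have h2 := hf0 m'
    rw [← hmm] at h2
    rw [dotProduct_add, dotProduct_smul, smul_eq_mul] at h1 h2
    exact mul_right_cancel₀ (hfu m) (add_right_cancel (h1.trans h2.symm))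
  rw [lineCard, ← Finset.card_filter_add_card_filter_not (s := S) (fun i => r i ⬝ᵥ u = 0)]
  refine Nat.add_le_add_left ?_ _
  rw [← Finset.card_univ]
  refine Finset.card_le_card_of_injOn f (fun m _ => ?_) hinj.injOn
  simp [hf, hfu]

lemma SmallBlocking.lineCard_pos (hB : SmallBlocking S r) {u : Fin 3 → F} (hu : u ≠ 0) :
    0 < lineCard S r u := by
  obtain ⟨i, hi, h⟩ := hB.block u hu
  exact Finset.card_pos.2 ⟨i, by simp [hi, h]⟩

lemma SmallBlocking.lt_card (hB : SmallBlocking S r) : q < S.card := by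
  have h1 : (1 : Fin 3 → F) ≠ 0 := one_ne_zero
  have h2 := hB.lineCard_add_le h1
  have h3 := hB.lineCard_pos h1
  omega

lemma SmallBlocking.cast_lineCard_of_ne (hB : SmallBlocking S r) {i₀ : ι} (hi₀ : i₀ ∈ S)
    {v : Fin 3 → F} (hv : r i₀ ⬝ᵥ v ≠ 0) : (lineCard S r v : F) = 1 := by
  classical
  obtain ⟨t, ht0, hti, htj⟩ := hB.tangent i₀ hi₀
  obtain ⟨u, w, hu, hw, hfr⟩ := exists_isFrame ht0 (hB.ne_zero _ hi₀) hti
  have hrt : ∀ i ∈ S.erase i₀, r i ⬝ᵥ t ≠ 0 := fun i hi h0 =>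
    (Finset.mem_erase.1 hi).1 (htj i (Finset.mem_erase.1 hi).2 h0)
  have hform : ∀ i ∈ S.erase i₀, ∀ x y : F, (r i ⬝ᵥ u / r i ⬝ᵥ t) * x + 1 * y +
      r i ⬝ᵥ w / r i ⬝ᵥ t = 0 ↔ r i ⬝ᵥ (y • t + x • u + w) = 0 := fun i hi x y => by
    have h0 := hrt i hi
    rw [← mul_right_inj' h0, mul_zero]
    refine Eq.congr ?_ rfl
    simp only [dotProduct_add, dotProduct_smul, smul_eq_mul]
    field_simp
    ring
  have hi0 : ∀ x y : F, r i₀ ⬝ᵥ (y • t + x • u + w) = 1 := fun x y => by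
    simp [dotProduct_add, hti, hu, hw]
  have hq := hB.lt_card
  have hsm := hB.small
  have key := card_filter_eq_one_of_tangents (S.erase i₀) (fun i => r i ⬝ᵥ u / r i ⬝ᵥ t)
    (fun i => r i ⬝ᵥ w / r i ⬝ᵥ t) (S.card - 1 - q)
    (by rw [Finset.card_erase_of_mem hi₀]; omega) (by omega)
    (fun x y => by
      obtain ⟨i, hi, h⟩ := hB.block (y • t + x • u + w) (fun h0 => by
        have := hi0 x y
        rw [h0, dotProduct_zero] at this
        exact zero_ne_one this)
      have hi' : i ∈ S.erase i₀ := Finset.mem_erase.2 ⟨fun h1 => by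
        rw [h1, hi0] at h; exact one_ne_zero h, hi⟩
      exact ⟨i, hi', (hform i hi' x y).2 h⟩)
    (fun i hi => by
      obtain ⟨s, hs0, hsi, hsj⟩ := hB.tangent i (Finset.mem_erase.1 hi).2
      obtain ⟨a, b, c, rfl⟩ := hfr.span s
      have hc : c ≠ 0 := fun hc => (Finset.mem_erase.1 hi).1 (hsj i₀ hi₀ (by
        simp [dotProduct_add, hti, hu, hc])).symm
      have hsc : ∀ j, r j ⬝ᵥ ((a / c) • t + (b / c) • u + w) = 0 ↔
          r j ⬝ᵥ (a • t + b • u + c • w) = 0 := fun j => by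
        rw [← mul_right_inj' hc, mul_zero]
        refine Eq.congr ?_ rfl
        simp only [dotProduct_add, dotProduct_smul, smul_eq_mul]
        field_simp
      refine ⟨b / c, a / c, (hform i hi _ _).2 ((hsc i).2 hsi), fun j hj h => ?_⟩
      exact hsj j (Finset.mem_erase.1 hj).2 ((hsc j).1 ((hform j hj _ _).1 h)))
  obtain ⟨a, b, c, rfl⟩ := hfr.span v
  have hc : c ≠ 0 := fun hc => hv (by simp [dotProduct_add, hti, hu, hc])
  rw [← key (b / c) (a / c), lineCard]
  congr 2
  ext i
  rw [Finset.mem_filter, Finset.mem_filter]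
  have hsc : r i ⬝ᵥ ((a / c) • t + (b / c) • u + w) = 0 ↔
      r i ⬝ᵥ (a • t + b • u + c • w) = 0 := by
    rw [← mul_right_inj' hc, mul_zero]
    refine Eq.congr ?_ rfl
    simp only [dotProduct_add, dotProduct_smul, smul_eq_mul]
    field_simp
  constructor
  · rintro ⟨hi, h⟩
    have hi' : i ∈ S.erase i₀ := Finset.mem_erase.2 ⟨fun h1 => hv (h1 ▸ h), hi⟩
    exact ⟨hi', (hform i hi' _ _).2 (hsc.2 h)⟩
  · rintro ⟨hi, h⟩
    exact ⟨(Finset.mem_erase.1 hi).2, hsc.1 ((hform i hi _ _).1 h)⟩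

lemma SmallBlocking.cast_lineCard (hB : SmallBlocking S r) {u : Fin 3 → F} (hu : u ≠ 0) :
    (lineCard S r u : F) = 1 := by
  obtain ⟨i, hi, h⟩ : ∃ i ∈ S, r i ⬝ᵥ u ≠ 0 := by
    by_contra! h
    have h1 := hB.lineCard_add_le hu
    rw [lineCard, Finset.filter_true_of_mem h] at h1
    have := Fintype.card_pos (α := F)
    omega
  exact hB.cast_lineCard_of_ne hi h

end Config

section DerivX

variable {R : Type*} [CommRing R]

/-- Derivative of a bivariate polynomial with respect to the inner variable. -/
noncomputable def derivX (f : R[X][X]) : R[X][X] :=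
  ∑ i ∈ f.support, monomial i (derivative (f.coeff i))

lemma coeff_derivX (f : R[X][X]) (i : ℕ) : (derivX f).coeff i = derivative (f.coeff i) := by
  simp only [derivX, finsetSum_coeff, coeff_monomial, Finset.sum_ite_eq', Polynomial.mem_support_iff]
  split_ifs with h
  · rfl
  · rw [notMem_support_iff.1 h, derivative_zero]

lemma derivX_add (f g : R[X][X]) : derivX (f + g) = derivX f + derivX g := by
  ext1 i; simp [coeff_derivX]

lemma derivX_sub (f g : R[X][X]) : derivX (f - g) = derivX f - derivX g := by
  ext1 i; simp [coeff_derivX]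

lemma derivX_zero : derivX (0 : R[X][X]) = 0 := by simp [derivX]

lemma derivX_X_mul (f : R[X][X]) : derivX (X * f) = X * derivX f := by
  ext1 i
  rcases i with _ | i <;> simp [coeff_derivX]

lemma derivX_C_mul (a : R[X]) (f : R[X][X]) :
    derivX (C a * f) = C (derivative a) * f + C a * derivX f := by
  ext1 i; simp [coeff_derivX]

lemma derivX_derivative (f : R[X][X]) : derivX (derivative f) = derivative (derivX f) := by
  ext1 i
  simp only [coeff_derivX, coeff_derivative, derivative_mul]
  rw [← Nat.cast_succ, derivative_natCast, mul_zero, add_zero]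

lemma TotDegLE.derivX {n : ℕ} {f : R[X][X]} (hf : TotDegLE (n + 1) f) : TotDegLE n (derivX f) := by
  intro i j hij
  rw [coeff_derivX, coeff_derivative, hf _ _ (by omega), zero_mul]

/-- Restriction of a bivariate polynomial to the line `(x + αT, y + βT)`. -/
noncomputable def restrictLine (α β x y : R) : R[X][X] →+* R[X] :=
  eval₂RingHom (eval₂RingHom C (C x + C α * X)) (C y + C β * X)

lemma restrictLine_X (α β x y : R) : restrictLine α β x y X = C y + C β * X := by
  simp [restrictLine]

lemma restrictLine_C_X (α β x y : R) : restrictLine α β x y (C X) = C x + C α * X := by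
  simp [restrictLine]

lemma restrictLine_C_C (α β x y c : R) : restrictLine α β x y (C (C c)) = C c := by
  simp [restrictLine]

lemma restrictLine_linForm (α β x y a b c : R) :
    restrictLine α β x y (linForm a b c) = C (a * x + b * y + c) + C (a * α + b * β) * X := by
  simp only [linForm, map_add, map_mul, restrictLine_X, restrictLine_C_X, restrictLine_C_C]
  ring

lemma eval_zero_restrictLine (α β x y : R) (f : R[X][X]) :
    (restrictLine α β x y f).eval 0 = f.evalEval x y := by
  have : (evalRingHom 0).comp (restrictLine α β x y) = evalEvalRingHom x y := by
    ext <;> simp [restrictLine]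
  exact congrFun (congrArg DFunLike.coe this) f

lemma derivative_restrictLine (α β x y : R) (f : R[X][X]) :
    derivative (restrictLine α β x y f) =
      C α * restrictLine α β x y (derivX f) + C β * restrictLine α β x y (derivative f) := by
  have hC : ∀ a : R[X], derivative (restrictLine α β x y (C a)) =
      C α * restrictLine α β x y (C (derivative a)) := fun a => by
    have h : ∀ b : R[X], restrictLine α β x y (C b) = b.comp (C x + C α * X) := fun b => by
      simp [restrictLine, comp]
    rw [h, h, derivative_comp]
    simp
  induction f using Polynomial.induction_on' with
  | add f g hf hg =>
    rw [map_add, derivative_add, hf, hg, derivX_add, map_add, map_add, map_add]; ring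
  | monomial n a =>
    have h1 : derivX (monomial n a) = C (derivative a) * X ^ n := by
      ext1 i
      rw [coeff_derivX, coeff_monomial, coeff_C_mul_X_pow]
      split_ifs <;> simp_all
    rw [h1, derivative_monomial, ← C_mul_X_pow_eq_monomial, ← C_mul_X_pow_eq_monomial]
    simp only [map_mul, map_pow, derivative_mul, hC, restrictLine_X, derivative_pow,
      derivative_add, derivative_C, derivative_X, map_natCast]
    ring

end DerivX

section Roots

variable {F : Type*} [Field F] {p : ℕ} [Fact p.Prime] [CharP F p]

lemma coeff_pow_char_mul (f : F[X]) (n : ℕ) : (f ^ p).coeff (n * p) = f.coeff n ^ p := by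
  rw [← map_frobenius_expand p f, coeff_map, coeff_expand_mul (Fact.out : p.Prime).pos,
    frobenius_def]

variable [Fintype F]

lemma exists_eq_pow_of_derivative_eq_zero {f : F[X]} (hf : derivative f = 0) :
    ∃ g : F[X], f = g ^ p := by
  have hlift : contract p f ∈ lifts (frobenius F p) := (lifts_iff_coeff_lifts _).2 fun n =>
    (bijective_frobenius F p).2 _
  obtain ⟨g, hg⟩ := (lifts_iff_set_range _).1 hlift
  refine ⟨g, ?_⟩
  rw [← expand_contract p hf (Fact.out : p.Prime).ne_zero, ← hg, ← map_frobenius_expand p g,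
    map_expand]

lemma exists_eq_pow_of_partials_eq_zero {f : F[X][X]} (h1 : derivX f = 0)
    (h2 : derivative f = 0) {d : ℕ} (hd : TotDegLE (p * d + 1) f) :
    ∃ g : F[X][X], f = g ^ p ∧ TotDegLE d g := by
  have hp := (Fact.out : p.Prime)
  have hlift : contract p f ∈ lifts (frobenius F[X] p) := (lifts_iff_coeff_lifts _).2 fun n => by
    rw [coeff_contract hp.ne_zero]
    have h3 := coeff_derivX f (n * p)
    rw [h1, coeff_zero] at h3
    obtain ⟨e, he⟩ := exists_eq_pow_of_derivative_eq_zero (p := p) h3.symm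
    exact ⟨e, he.symm⟩
  obtain ⟨g, hg⟩ := (lifts_iff_set_range _).1 hlift
  have hfg : f = expand F[X] p (map (frobenius F[X] p) g) := by
    rw [hg, expand_contract p h2 hp.ne_zero]
  refine ⟨g, by rw [hfg, ← map_frobenius_expand p g, map_expand], fun i j hij => ?_⟩
  have h3 := hd (i * p) (j * p) (by have := hp.two_le; nlinarith)
  rw [hfg, coeff_expand_mul hp.pos, coeff_map, frobenius_def, coeff_pow_char_mul] at h3
  exact (pow_eq_zero_iff hp.ne_zero).1 h3

variable [DecidableEq F]

lemma exists_structure {ι : Type*} (S : Finset ι) (l₁ l₂ l₃ : ι → F) {n d : ℕ}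
    (hq : Fintype.card F = p ^ n)
    (hS : S.card = p ^ n + 1 + p * d) (hd : p * d < p ^ n)
    (h1 : ∀ x y, ((S.filter fun i => l₁ i * x + l₂ i * y + l₃ i = 0).card : F) = 1) :
    ∃ F₁ F₂ F₃ : F[X][X], TotDegLE d F₁ ∧ TotDegLE d F₂ ∧ TotDegLE d F₃ ∧
      ∏ i ∈ S, linForm (l₁ i) (l₂ i) (l₃ i) =
        (X ^ p ^ n - X) * (F₁ ^ p - C X * F₃ ^ p) + C (X ^ p ^ n - X) * (X * F₃ ^ p - F₂ ^ p) := by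
  have hHT := TotDegLE.prod S _ fun i _ => TotDegLE.linForm (l₁ i) (l₂ i) (l₃ i)
  set H := ∏ i ∈ S, linForm (l₁ i) (l₂ i) (l₃ i) with hH
  obtain ⟨f, g, e, hf, hg⟩ := exists_eq_of_forall_evalEval_eq_zero hHT fun x y => by
    refine evalEval_prod_linForm_eq_zero S _ _ _ x y ?_
    by_contra! h
    have := h1 x y
    rw [Finset.filter_false_of_mem h] at this
    simp at this
  rw [hq] at e
  rw [show S.card - Fintype.card F = p * d + 1 by omega] at hf hg
  have hdir : ∀ α β x y : F, β * (α * (derivX f).evalEval x y + β * (derivative f).evalEval x y) +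
      α * (α * (derivX g).evalEval x y + β * (derivative g).evalEval x y) = 0 := fun α β x y => by
    have hK := derivative_eq_zero_of_card_eq_one S (fun i => l₁ i * x + l₂ i * y + l₃ i)
      (fun i => l₁ i * α + l₂ i * β)
      (C β * restrictLine α β x y f + C α * restrictLine α β x y g) ?_ ?_
    · have h2 := congrArg (eval 0) hK
      simp only [derivative_add, derivative_C_mul, derivative_restrictLine, eval_add, eval_mul,
        eval_C, eval_zero_restrictLine, eval_zero] at h2
      exact h2
    · rw [← Finset.prod_congr rfl fun i _ => restrictLine_linForm α β x y (l₁ i) (l₂ i) (l₃ i),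
        ← map_prod, ← hH, e, hq]
      have h3 : ∀ a b : F, (C a + C b * X : F[X]) ^ p ^ n - (C a + C b * X) =
          C b * (X ^ p ^ n - X) := fun a b => by
        rw [add_pow_char_pow, mul_pow, ← C_pow, ← C_pow, ← hq, FiniteField.pow_card,
          FiniteField.pow_card]
        ring
      simp only [map_add, map_mul, map_sub, map_pow, restrictLine_X, restrictLine_C_X, h3]
      ring
    · intro t
      rw [← h1 (x + α * t) (y + β * t)]
      congr 2
      exact Finset.filter_congr fun i _ => by ring_nf
  have hpd : p * d < Fintype.card F := by rw [hq]; exact hd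
  have hgx : derivX g = 0 := hg.derivX.eq_zero hpd fun x y => by simpa using hdir 1 0 x y
  have hfy : derivative f = 0 := hf.derivative.eq_zero hpd fun x y => by simpa using hdir 0 1 x y
  have hfg : derivX f + derivative g = 0 :=
    (hf.derivX.add hg.derivative).eq_zero hpd fun x y => by
      have := hdir 1 1 x y
      rw [hgx, hfy] at this
      simpa using this
  have hfx : derivX f = - derivative g := eq_neg_of_add_eq_zero_left hfg
  have hCx : derivX (derivative g) = 0 := by rw [derivX_derivative, hgx, derivative_zero]
  have hCy : derivative (derivative g) = 0 := by
    have : derivative g = - derivX f := by rw [hfx, neg_neg]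
    rw [this, derivative_neg, ← derivX_derivative, hfy, derivX_zero, neg_zero]
  have hXT : TotDegLE 1 (X : F[X][X]) := by
    have := TotDegLE.linForm (0 : F) 1 0
    simpa [linForm] using this
  have hXT' : TotDegLE 1 (C X : F[X][X]) := by
    have := TotDegLE.linForm (1 : F) 0 0
    simpa [linForm] using this
  obtain ⟨F₃, h3, h3T⟩ := exists_eq_pow_of_partials_eq_zero (p := p) (d := d) hCx hCy
    (hg.derivative.mono (Nat.le_succ _))
  obtain ⟨F₂, h2, h2T⟩ := exists_eq_pow_of_partials_eq_zero (p := p) (d := d)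
    (f := X * derivative g - g)
    (by rw [derivX_sub, derivX_X_mul, hCx, hgx]; simp)
    (by rw [derivative_sub, derivative_mul, hCy]; simp)
    (((hXT.mul hg.derivative).mono (by omega)).sub hg)
  obtain ⟨F₁, h1, h1T⟩ := exists_eq_pow_of_partials_eq_zero (p := p) (d := d)
    (f := f + C X * derivative g)
    (by rw [derivX_add, derivX_C_mul, hCx, hfx]; simp)
    (by rw [derivative_add, derivative_mul, hCy, hfy]; simp)
    (hf.add ((hXT'.mul hg.derivative).mono (by omega)))
  refine ⟨F₁, F₂, F₃, h1T, h2T, h3T, ?_⟩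
  rw [e, ← h1, ← h2, ← h3]
  ring

end Roots

section Pencil

variable {F : Type*} [Field F] {p : ℕ} [Fact p.Prime] [CharP F p] {ι : Type*}

lemma eq_of_prod_structure [Fintype F] (hq : Fintype.card F = p ^ 3) {s : Finset ι}
    {l₁ l₂ l₃ : ι → F} {F₁ F₂ F₃ : F[X][X]}
    (hH : ∏ i ∈ s, linForm (l₁ i) (l₂ i) (l₃ i) =
        (X ^ p ^ 3 - X) * (F₁ ^ p - C X * F₃ ^ p) + C (X ^ p ^ 3 - X) * (X * F₃ ^ p - F₂ ^ p))
    {i : ι} (hi : i ∈ s) (m a : F) (hl : ∀ x, l₁ i * x + l₂ i * (m + a * x) + l₃ i = 0) :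
    F₂.eval (C m + C a * X) = C (a ^ p ^ 2) * F₁.eval (C m + C a * X) +
      C (m ^ p ^ 2) * F₃.eval (C m + C a * X) := by
  have hp := (Fact.out : p.Prime)
  set y : F[X] := C m + C a * X with hy
  have h3 : y ^ p ^ 3 - y = C a * (X ^ p ^ 3 - X) := by
    rw [hy, add_pow_char_pow, mul_pow, ← C_pow, ← C_pow, ← hq, FiniteField.pow_card,
      FiniteField.pow_card]
    ring
  have h1 : l₁ i + l₂ i * a = 0 := by linear_combination hl 1 - hl 0
  have h2 : l₂ i * m + l₃ i = 0 := by linear_combination hl 0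
  have h0 : (linForm (l₁ i) (l₂ i) (l₃ i)).eval y = 0 := by
    have : (linForm (l₁ i) (l₂ i) (l₃ i)).eval y = C (l₂ i * m + l₃ i) + C (l₁ i + l₂ i * a) * X := by
      simp only [linForm, hy, eval_add, eval_mul, eval_C, eval_X, map_add, map_mul]; ring
    rw [this, h1, h2]; simp
  have hz := congrArg (eval y) hH
  rw [eval_prod, Finset.prod_eq_zero hi h0] at hz
  simp only [eval_add, eval_mul, eval_sub, eval_pow, eval_C, eval_X, h3] at hz
  have hne : (X ^ p ^ 3 - X : F[X]) ≠ 0 := hq ▸ X_pow_card_sub_X_ne_zero'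
  have hpow : ∀ t : F, C t = (C (t ^ p ^ 2) : F[X]) ^ p := fun t => by
    rw [← C_pow, ← pow_mul, ← pow_succ, ← hq, FiniteField.pow_card]
  have h4 : (X ^ p ^ 3 - X) * ((C (a ^ p ^ 2) * F₁.eval y + C (m ^ p ^ 2) * F₃.eval y -
      F₂.eval y) ^ p) = 0 := by
    rw [sub_pow_char, add_pow_char, mul_pow, mul_pow, ← hpow, ← hpow]
    linear_combination -hz + (X ^ p ^ 3 - X) * eval y F₃ ^ p * hy
  have h5 := (pow_eq_zero_iff hp.ne_zero).1 ((mul_eq_zero.1 h4).resolve_left hne)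
  exact (sub_eq_zero.1 h5).symm

lemma eval_eval_eq_evalEval {R : Type*} [CommRing R] (f : R[X][X]) (g : R[X]) (t : R) :
    (f.eval g).eval t = f.evalEval t (g.eval t) := by
  induction f using Polynomial.induction_on' with
  | add f g hf hg => simp_all [evalEval]
  | monomial n a => simp [evalEval]

lemma exists_eq_C_X_mul {R : Type*} [CommRing R] {f : R[X][X]}
    (h : f.map (evalRingHom 0) = 0) : ∃ g, f = C X * g := by
  refine (C_dvd_iff_dvd_coeff _ _).2 fun i => ?_
  rw [X_dvd_iff, coeff_zero_eq_eval_zero]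
  simpa using congrArg (fun g => coeff g i) h

lemma exists_pow_dvd_of_rootMultiplicity_eq_one {F₂ F₃ G₁ : F[X][X]} {m : F}
    (hm : (X ^ p ^ 2 * F₃.map (evalRingHom 0) - F₂.map (evalRingHom 0)).rootMultiplicity m = 1)
    {A : Finset F} (hA : A.card = p)
    (h : ∀ a ∈ A, F₂.eval (C m + C a * X) =
      C (a ^ p ^ 2) * (C X * G₁).eval (C m + C a * X) +
      C (m ^ p ^ 2) * F₃.eval (C m + C a * X)) :
    ∃ s : F, s ≠ 0 ∧ (X - C m) ^ p ∣ F₂.map (evalRingHom 0) -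
      C (m ^ p ^ 2) * F₃.map (evalRingHom 0) - C s * ((X - C m) * G₁.map (evalRingHom 0)) := by
  have hp := (Fact.out : p.Prime)
  set c := F₃.map (evalRingHom 0) with hc
  set a := F₂.map (evalRingHom 0) with ha
  set ω := G₁.map (evalRingHom 0) with hω
  set Ψ : F[X][X] := F₂ - C (C (m ^ p ^ 2)) * F₃ with hΨ
  set ψ : F[X] := a - C (m ^ p ^ 2) * c with hψ
  have hφ : X ^ p ^ 2 * c - a = (X - C m) ^ p ^ 2 * c - ψ := by
    rw [sub_pow_char_pow, hψ, C_pow]; ring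
  have hφ0 : X ^ p ^ 2 * c - a ≠ 0 := fun h0 => by rw [h0] at hm; simp at hm
  have hp2 : 2 ≤ p ^ 2 := by have := hp.two_le; nlinarith
  have hψm : ψ.eval m = 0 := by
    have h1 := (rootMultiplicity_pos hφ0).1 (by rw [hm]; exact one_pos)
    rw [hφ, IsRoot] at h1
    have hz : (0 : F) ^ p ^ 2 = 0 := zero_pow (by omega)
    simpa [hz] using h1
  obtain ⟨ψ₁, hψ₁⟩ := dvd_iff_isRoot.2 hψm
  have hδ : ψ₁.eval m ≠ 0 := fun h0 => by
    obtain ⟨ψ₂, hψ₂⟩ := dvd_iff_isRoot.2 h0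
    have h2 : (X - C m) ^ 2 ∣ X ^ p ^ 2 * c - a := by
      rw [hφ, hψ₁, hψ₂, ← mul_assoc, ← pow_two]
      exact dvd_sub ((pow_dvd_pow _ hp2).mul_right _) (dvd_mul_right _ _)
    have := (le_rootMultiplicity_iff hφ0).2 h2
    omega
  obtain ⟨Ψ₁, hΨ₁⟩ := exists_eq_C_X_mul (f := Ψ - ψ.map C) (by
    rw [Polynomial.map_sub, hΨ, Polynomial.map_sub, Polynomial.map_mul, Polynomial.map_map,
      ← ha, ← hc]
    have : (evalRingHom (0 : F)).comp C = RingHom.id F := by ext; simp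
    rw [this, Polynomial.map_id, hψ]
    simp)
  have hline : ∀ a ∈ A, Ψ.eval (C m + C a * X) = C (a ^ p ^ 2) * (C X * G₁).eval (C m + C a * X) :=
    fun a ha => by
      rw [hΨ, eval_sub, h a ha]
      simp only [eval_mul, eval_C]
      ring
  have hrel : ∀ a ∈ A, a * ψ₁.eval m + Ψ₁.evalEval 0 m = a ^ p ^ 2 * G₁.evalEval 0 m :=
    fun a ha => by
      have h1 := hline a ha
      rw [← sub_add_cancel Ψ (ψ.map C), hΨ₁, hψ₁] at h1
      simp only [eval_add, eval_mul, eval_C, eval_map, eval₂_mul, eval₂_sub, eval₂_X, eval₂_C,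
        add_sub_cancel_left] at h1
      have h2 : X * (C a * ψ₁.comp (C m + C a * X) + Ψ₁.eval (C m + C a * X) -
          C (a ^ p ^ 2) * G₁.eval (C m + C a * X)) = 0 := by
        rw [comp]; linear_combination h1
      have h3 := congrArg (eval 0) ((mul_eq_zero.1 h2).resolve_left X_ne_zero)
      simp only [eval_sub, eval_add, eval_mul, eval_C, eval_eval_eq_evalEval, eval_comp, eval_X,
        mul_zero, add_zero, eval_zero] at h3
      simp only [eval_C] at h3
      linear_combination h3
  set δ := ψ₁.eval m
  set γ := Ψ₁.evalEval 0 m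
  set α := G₁.evalEval 0 m
  have hα : α ≠ 0 := fun h0 => by
    have : A.card ≤ 1 := Finset.card_le_one.2 fun x hx y hy => by
      have h1 := hrel x hx
      have h2 := hrel y hy
      rw [h0, mul_zero] at h1 h2
      exact mul_right_cancel₀ hδ (by linear_combination h1 - h2)
    have := hp.two_le
    omega
  set M : F[X][X] := C (C α) * Ψ - C (C γ) * (C X * G₁) - C (C δ) * ((X - C (C m)) * G₁) with hM
  have hroot : ∀ a ∈ A, M.eval (C m + C a * X) = 0 := fun a ha => by
    have h1 := hline a ha
    have h2 := congrArg C (hrel a ha)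
    simp only [C_add, C_mul] at h2
    rw [hM]
    simp only [eval_sub, eval_mul, eval_C, eval_X, h1]
    linear_combination (-X * eval (C m + C a * X) G₁) * h2
  have hdvd : ∏ a ∈ A, (X - C (C m + C a * X)) ∣ M := by
    refine Finset.prod_dvd_of_isRelPrime (fun x _ y _ hxy => ?_) fun x hx => ?_
    · refine ((prime_X_sub_C _).irreducible.isRelPrime_iff_not_dvd).2 fun h0 => hxy ?_
      rw [dvd_iff_isRoot, IsRoot] at h0
      simp only [eval_sub, eval_X, eval_C, add_sub_add_left_eq_sub, ← sub_mul, ← C_sub] at h0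
      have := congrArg (fun f => coeff f 1) h0
      simp at this
      exact sub_eq_zero.1 this
    · exact dvd_iff_isRoot.2 (hroot x hx)
  have hdvd' := Polynomial.map_dvd (evalRingHom (0 : F)) hdvd
  rw [Polynomial.map_prod, Finset.prod_congr rfl (g := fun _ => X - C m) (fun x _ => by simp),
    Finset.prod_const, hA] at hdvd'
  have hM' : M.map (evalRingHom 0) = C α * (ψ - C (δ / α) * ((X - C m) * ω)) := by
    have h1 : (C α : F[X]) * C (δ / α) = C δ := by rw [← C_mul, mul_div_cancel₀ _ hα]
    have h2 : M.map (evalRingHom 0) = C α * ψ - C δ * ((X - C m) * ω) := by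
      rw [hM, hΨ, hψ]; simp [← ha, ← hc, ← hω]
    rw [h2]
    linear_combination ((X - C m) * ω) * h1
  rw [hM'] at hdvd'
  refine ⟨δ / α, div_ne_zero hδ hα, ?_⟩
  exact (IsUnit.dvd_mul_left (isUnit_C.2 hα.isUnit)).1 hdvd'

end Pencil

section PencilOfBlocking

variable {F : Type*} [Field F] [Fintype F] [DecidableEq F] {p : ℕ} [Fact p.Prime] [CharP F p]
  {ι : Type*} {S : Finset ι} {r : ι → Fin 3 → F}

lemma SmallBlocking.exists_pencil (hB : SmallBlocking S r) (hq : Fintype.card F = p ^ 3) {d : ℕ}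
    (hcard : S.card = p ^ 3 + 1 + p * d) (hpd : p * d < p ^ 3) {i₀ : ι} (hi₀ : i₀ ∈ S)
    {u v w : Fin 3 → F} (hfr : IsFrame u v w) (hu : r i₀ ⬝ᵥ u = 0) (hv : r i₀ ⬝ᵥ v = 0)
    (hw : r i₀ ⬝ᵥ w = 1) :
    ∃ a c ω : F[X], a.natDegree ≤ d ∧ c.natDegree ≤ d ∧ ω.natDegree ≤ d - 1 ∧
      X ^ p ^ 2 * c - a ≠ 0 ∧ (X ^ p ^ 2 * c - a).Splits ∧
      p * (X ^ p ^ 2 * c - a).natDegree + lineCard S r u = S.card ∧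
      (∀ m, lineCard S r (m • u + v) = 1 + p * (X ^ p ^ 2 * c - a).rootMultiplicity m) ∧
      ∀ m, (X ^ p ^ 2 * c - a).rootMultiplicity m = 1 →
        ∃ s : F, s ≠ 0 ∧ (X - C m) ^ p ∣ a - C (m ^ p ^ 2) * c - C s * ((X - C m) * ω) := by
  classical
  have hp := (Fact.out : p.Prime)
  have hp0 := hp.ne_zero
  have hne : ∀ x y : F, x • w + y • u + v ≠ 0 := fun x y h0 =>
    one_ne_zero (hfr.indep y 1 x (by rw [← h0]; module)).2.1
  have hline : ∀ i, ∀ x y : F, r i ⬝ᵥ w * x + r i ⬝ᵥ u * y + r i ⬝ᵥ v =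
      r i ⬝ᵥ (x • w + y • u + v) := fun i x y => by
    simp only [dotProduct_add, dotProduct_smul, smul_eq_mul]; ring
  obtain ⟨F₁, F₂, F₃, h1, h2, h3, hH⟩ := exists_structure S (fun i => r i ⬝ᵥ w)
    (fun i => r i ⬝ᵥ u) (fun i => r i ⬝ᵥ v) hq hcard hpd (fun x y => by
      simp only [hline]; exact hB.cast_lineCard (hne x y))
  have hl0 : linForm (r i₀ ⬝ᵥ w) (r i₀ ⬝ᵥ u) (r i₀ ⬝ᵥ v) = C X := by
    rw [hu, hv, hw]; simp [linForm]
  have hH₀ := hH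
  rw [← Finset.mul_prod_erase S _ hi₀, hl0] at hH
  set H := ∏ i ∈ S.erase i₀, linForm (r i ⬝ᵥ w) (r i ⬝ᵥ u) (r i ⬝ᵥ v) with hHdef
  have hq0 : (0 : F[X]) ^ p ^ 3 = 0 := zero_pow (pow_ne_zero _ hp0)
  have hF1 : F₁.map (evalRingHom 0) = 0 := by
    have h4 := congrArg (Polynomial.map (evalRingHom (0 : F))) hH
    have h5 : (X ^ p ^ 3 - X : F[X]) * (F₁.map (evalRingHom 0)) ^ p = 0 := by
      simpa [hq0] using h4.symm
    have hne : (X ^ p ^ 3 - X : F[X]) ≠ 0 := hq ▸ X_pow_card_sub_X_ne_zero'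
    exact (pow_eq_zero_iff hp0).1 ((mul_eq_zero.1 h5).resolve_left hne)
  obtain ⟨G₁, hG⟩ := exists_eq_C_X_mul hF1
  have hH' : H = (X ^ p ^ 3 - X) * (C X ^ (p - 1) * G₁ ^ p - F₃ ^ p) +
      C (X ^ (p ^ 3 - 1) - 1) * (X * F₃ ^ p - F₂ ^ p) := by
    have hCX : (C X : F[X][X]) ≠ 0 := by simp
    refine mul_left_cancel₀ hCX ?_
    rw [hH, hG, mul_pow]
    have e1 : (C X : F[X][X]) ^ p = C X * C X ^ (p - 1) := by
      rw [← pow_succ', Nat.sub_add_cancel hp.one_le]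
    have e2 : (X : F[X]) ^ p ^ 3 = X * X ^ (p ^ 3 - 1) := by
      rw [← pow_succ', Nat.sub_add_cancel (Nat.one_le_pow _ _ hp.pos)]
    rw [e1, e2]
    simp only [C_sub, C_mul, C_1]
    ring
  set a := F₂.map (evalRingHom 0) with ha
  set c := F₃.map (evalRingHom 0) with hc
  set ω := G₁.map (evalRingHom 0) with hω
  set φ : F[X] := X ^ p ^ 2 * c - a with hφ
  have hprod : ∏ i ∈ S.erase i₀, (C (r i ⬝ᵥ v) + C (r i ⬝ᵥ u) * X) = (-φ) ^ p := by
    have h4 := congrArg (Polynomial.map (evalRingHom (0 : F))) hH'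
    rw [hHdef, map_prod_linForm] at h4
    simp only [mul_zero, zero_add] at h4
    rw [h4, hφ, neg_sub, sub_pow_char, mul_pow, ← pow_mul, ← pow_succ]
    have e3 : (0 : F[X]) ^ (p - 1) = 0 := zero_pow (by have := hp.two_le; omega)
    have e4 : (0 : F[X]) ^ (p ^ 3 - 1) = 0 := zero_pow (by
      have : 1 < p ^ 3 := Nat.one_lt_pow (by norm_num) hp.one_lt
      omega)
    simp [e3, e4, ← ha, ← hc]
    ring
  have hnz : ∀ i ∈ S.erase i₀, r i ⬝ᵥ u = 0 → r i ⬝ᵥ v ≠ 0 := fun i hi e1 e2 =>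
    (Finset.mem_erase.1 hi).1 (hB.eq_of_smul i (Finset.mem_erase.1 hi).2 i₀ hi₀ _
      (eq_smul_of_isFrame hfr hu hv hw e1 e2))
  have hfac : ∀ i ∈ S.erase i₀, (C (r i ⬝ᵥ v) + C (r i ⬝ᵥ u) * X : F[X]) ≠ 0 := fun i hi h0 => by
    have e1 := congrArg (fun f => coeff f 0) h0
    have e2 := congrArg (fun f => coeff f 1) h0
    simp at e1 e2
    exact hnz i hi e2 e1
  have hprod0 := Finset.prod_ne_zero_iff.2 hfac
  have hφ0 : φ ≠ 0 := fun h0 => by rw [hprod, h0, neg_zero, zero_pow hp0] at hprod0; exact hprod0 rfl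
  have hrm : ∀ m, ((S.erase i₀).filter fun i => r i ⬝ᵥ v + r i ⬝ᵥ u * m = 0).card =
      p * φ.rootMultiplicity m := fun m => by
    rw [← rootMultiplicity_prod_linear (S.erase i₀) (fun i => r i ⬝ᵥ v) (fun i => r i ⬝ᵥ u) hprod0,
      hprod, ← count_roots, roots_pow, Multiset.count_nsmul, roots_neg, count_roots]
  have hlm : ∀ i m, r i ⬝ᵥ v + r i ⬝ᵥ u * m = r i ⬝ᵥ (m • u + v) := fun i m => by
    simp only [dotProduct_add, dotProduct_smul, smul_eq_mul]; ring
  have hlc : ∀ m, lineCard S r (m • u + v) = 1 + p * φ.rootMultiplicity m := fun m => by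
    rw [← hrm m, lineCard]
    simp only [hlm]
    rw [Finset.filter_erase, Finset.card_erase_of_mem (by simp [hi₀, hu, hv])]
    have : 0 < (S.filter fun i => r i ⬝ᵥ (m • u + v) = 0).card :=
      Finset.card_pos.2 ⟨i₀, by simp [hi₀, hu, hv]⟩
    omega
  refine ⟨a, c, ω, natDegree_map_le.trans h2.natDegree_le, natDegree_map_le.trans h3.natDegree_le,
    ?_, hφ0, ?_, ?_, hlc, fun m hm => ?_⟩
  · refine natDegree_le_iff_coeff_eq_zero.2 fun n hn => ?_
    have h4 := h1 n 1 (by omega)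
    rw [hG, coeff_C_mul, coeff_X_mul] at h4
    rw [hω, coeff_map, coe_evalRingHom, ← coeff_zero_eq_eval_zero, h4]
  · have h4 : (-φ).Splits := by
      have h5 := splits_prod_linear (S.erase i₀) (fun i => r i ⬝ᵥ v) (fun i => r i ⬝ᵥ u)
      rw [hprod] at h5
      exact h5.of_dvd (hprod ▸ hprod0) (dvd_pow_self _ hp0)
    simpa using h4.neg
  · have h4 := congrArg natDegree hprod
    rw [natDegree_pow, natDegree_neg, natDegree_prod _ _ hfac] at h4
    have h5 : ∀ i ∈ S.erase i₀, (C (r i ⬝ᵥ v) + C (r i ⬝ᵥ u) * X : F[X]).natDegree =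
        if r i ⬝ᵥ u = 0 then 0 else 1 := fun i _ => by
      split_ifs with h6
      · simp [h6]
      · rw [add_comm, natDegree_linear h6]
    rw [Finset.sum_congr rfl h5, Finset.sum_ite, Finset.sum_const_zero, zero_add, Finset.sum_const,
      smul_eq_mul, mul_one] at h4
    rw [← h4, lineCard, ← Finset.card_filter_add_card_filter_not (s := S)
      (fun i => r i ⬝ᵥ u = 0), add_comm]
    congr 2
    rw [Finset.filter_erase, Finset.erase_eq_of_notMem (by simp [hu])]
  · set A₀ := (S.erase i₀).filter fun i => r i ⬝ᵥ v + r i ⬝ᵥ u * m = 0 with hA₀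
    have hA₀mem : ∀ i ∈ A₀, i ∈ S.erase i₀ ∧ r i ⬝ᵥ v + r i ⬝ᵥ u * m = 0 := fun i hi =>
      Finset.mem_filter.1 hi
    have hu0 : ∀ i ∈ A₀, r i ⬝ᵥ u ≠ 0 := fun i hi h6 => by
      obtain ⟨h4, h5⟩ := hA₀mem i hi
      refine hnz i h4 h6 ?_
      rwa [h6, zero_mul, add_zero] at h5
    refine exists_pow_dvd_of_rootMultiplicity_eq_one hm
      (A := A₀.image fun i => -(r i ⬝ᵥ w / r i ⬝ᵥ u)) ?_ ?_
    · rw [Finset.card_image_of_injOn, hA₀, hrm m, hm, mul_one]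
      intro i hi j hj hij
      have hi' := hA₀mem i hi
      have hj' := hA₀mem j hj
      have hui := hu0 i hi
      have huj := hu0 j hj
      refine hB.eq_of_smul i (Finset.mem_erase.1 hi'.1).2 j (Finset.mem_erase.1 hj'.1).2
        (r i ⬝ᵥ u / r j ⬝ᵥ u) ?_
      rw [← sub_eq_zero]
      simp only [neg_inj] at hij
      rw [div_eq_div_iff hui huj] at hij
      refine hfr.eq_zero ?_ ?_ ?_ <;> rw [sub_dotProduct, smul_dotProduct, smul_eq_mul] <;>
        field_simp
      · ring
      · linear_combination (r j ⬝ᵥ u) * hi'.2 - (r i ⬝ᵥ u) * hj'.2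
      · linear_combination hij
    · intro b hb
      obtain ⟨i, hi, rfl⟩ := Finset.mem_image.1 hb
      have hui := hu0 i hi
      rw [← hG]
      refine eq_of_prod_structure hq hH₀ (Finset.mem_erase.1 (hA₀mem i hi).1).2 m _ fun x => ?_
      field_simp
      linear_combination (hA₀mem i hi).2

end PencilOfBlocking

section Counting

variable {F : Type*} [Field F] [Fintype F] [DecidableEq F] {ι : Type*}

local notation "q" => Fintype.card F

lemma card_ker_mul {V : Type*} [AddCommGroup V] [Module F V] (f : V →ₗ[F] F)
    (hf : ∃ x, f x ≠ 0) : Nat.card (LinearMap.ker f) * q = Nat.card V := by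
  obtain ⟨x, hx⟩ := hf
  have hs : Function.Surjective f := fun y => ⟨(y / f x) • x, by
    rw [map_smul, smul_eq_mul, div_mul_cancel₀ _ hx]⟩
  rw [Submodule.card_eq_card_quotient_mul_card (LinearMap.ker f),
    Nat.card_congr (f.quotKerEquivOfSurjective hs).toEquiv, Nat.card_eq_fintype_card (α := F), mul_comm]

lemma card_filter_dotProduct {T : Fin 3 → F} (hT : T ≠ 0) :
    (Finset.univ.filter fun u => T ⬝ᵥ u = 0).card = q ^ 2 := by
  have h := card_ker_mul (dotProductBilin F F T) (by
    by_contra! h0; exact hT (dotProduct_eq_zero_iff.1 h0))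
  have h2 : Nat.card (LinearMap.ker (dotProductBilin F F T)) =
      (Finset.univ.filter fun u => T ⬝ᵥ u = 0).card := by
    rw [← Fintype.card_subtype, ← Nat.card_eq_fintype_card]
    rfl
  rw [h2, Nat.card_eq_fintype_card, Fintype.card_fun, Fintype.card_fin] at h
  exact Nat.eq_of_mul_eq_mul_right Fintype.card_pos (h.trans (pow_succ _ _))

lemma card_filter_dotProduct_and {T T' : Fin 3 → F} (hT : T ≠ 0) (hTT' : ∀ c : F, T' ≠ c • T) :
    (Finset.univ.filter fun u => T ⬝ᵥ u = 0 ∧ T' ⬝ᵥ u = 0).card = q := by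
  have h := card_ker_mul ((dotProductBilin F F T').domRestrict
      (LinearMap.ker (dotProductBilin F F T))) (by
    by_contra! h0
    obtain ⟨u, hu, huT⟩ : ∃ u, u ≠ 0 ∧ T ⬝ᵥ u = 0 := by
      have h2 : 1 < (Finset.univ.filter fun u => T ⬝ᵥ u = 0).card := by
        rw [card_filter_dotProduct hT]
        exact Nat.one_lt_pow two_ne_zero Fintype.one_lt_card
      obtain ⟨u, hu, hu0⟩ := Finset.exists_mem_ne h2 0
      exact ⟨u, hu0, (Finset.mem_filter.1 hu).2⟩
    obtain ⟨v, w, hv, hw, hfr⟩ := exists_isFrame hu hT huT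
    exact hTT' _ (eq_smul_of_isFrame hfr huT hv hw (h0 ⟨u, huT⟩) (h0 ⟨v, hv⟩)))
  have h2 : Nat.card (LinearMap.ker ((dotProductBilin F F T').domRestrict
      (LinearMap.ker (dotProductBilin F F T)))) =
      (Finset.univ.filter fun u => T ⬝ᵥ u = 0 ∧ T' ⬝ᵥ u = 0).card := by
    rw [← Fintype.card_subtype, ← Nat.card_eq_fintype_card]
    refine Nat.card_congr ⟨fun x => ⟨x.1.1, x.1.2, x.2⟩, fun x => ⟨⟨x.1, x.2.1⟩, x.2.2⟩,
      fun x => rfl, fun x => rfl⟩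
  have h3 : Nat.card (LinearMap.ker (dotProductBilin F F T)) = q ^ 2 := by
    rw [← card_filter_dotProduct hT, ← Fintype.card_subtype, ← Nat.card_eq_fintype_card]
    rfl
  rw [h2, h3] at h
  exact Nat.eq_of_mul_eq_mul_right Fintype.card_pos (h.trans (pow_two _))

variable {S : Finset ι} {r : ι → Fin 3 → F}

lemma lineCard_eq_sum (u : Fin 3 → F) :
    (lineCard S r u : ℤ) = ∑ i ∈ S, if r i ⬝ᵥ u = 0 then 1 else 0 := by
  rw [lineCard, Finset.card_filter]; push_cast; rfl

lemma lineCard_zero : lineCard S r 0 = S.card := by simp [lineCard]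

lemma SmallBlocking.sum_lineCard (hB : SmallBlocking S r) :
    ∑ u, (lineCard S r u : ℤ) = S.card * q ^ 2 := by
  simp only [lineCard_eq_sum]
  rw [Finset.sum_comm, Finset.sum_congr rfl (g := fun _ => (q : ℤ) ^ 2) fun i hi => ?_]
  · simp
  · rw [Finset.sum_boole, card_filter_dotProduct (hB.ne_zero i hi)]; push_cast; rfl

lemma SmallBlocking.sum_lineCard_sq (hB : SmallBlocking S r) :
    ∑ u, (lineCard S r u : ℤ) ^ 2 = S.card * (q ^ 2 + (S.card - 1) * q) := by
  classical
  simp only [lineCard_eq_sum, pow_two, Finset.sum_mul_sum]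
  rw [Finset.sum_comm, Finset.sum_congr rfl (g := fun _ => (q : ℤ) ^ 2 + (S.card - 1) * q)
    fun i hi => ?_]
  · simp [pow_two]
  · rw [Finset.sum_comm, ← Finset.add_sum_erase _ _ hi,
      Finset.sum_congr (s₁ := S.erase i) rfl (g := fun _ => (q : ℤ))
      fun j hj => ?_]
    · rw [Finset.sum_const, Finset.card_erase_of_mem hi, nsmul_eq_mul,
        Nat.cast_sub (Finset.card_pos.2 ⟨i, hi⟩)]
      simp only [ite_mul, one_mul, zero_mul, ← ite_and, and_self]
      rw [Finset.sum_boole, card_filter_dotProduct (hB.ne_zero i hi)]; push_cast; rfl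
    · simp only [ite_mul, one_mul, zero_mul, ← ite_and]
      rw [Finset.sum_boole, card_filter_dotProduct_and (hB.ne_zero i hi) fun c hc => ?_]
      obtain ⟨h1, h2⟩ := Finset.mem_erase.1 hj
      exact h1 (hB.eq_of_smul j h2 i hi c hc)

end Counting

section Excess

variable {F : Type*} [Field F] [Fintype F] [DecidableEq F] {ι : Type*} {p : ℕ}
  {S : Finset ι} {r : ι → Fin 3 → F}

local notation "q" => Fintype.card F

/-- The number `j` such that the line `u` contains `1 + p * j` points. -/
def excess (p : ℕ) (S : Finset ι) (r : ι → Fin 3 → F) (u : Fin 3 → F) : ℕ :=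
  (lineCard S r u - 1) / p

lemma excess_eq (hp : 0 < p) {u : Fin 3 → F} {j : ℕ} (h : lineCard S r u = 1 + p * j) :
    excess p S r u = j := by
  rw [excess, h, Nat.add_sub_cancel_left, Nat.mul_div_cancel_left _ hp]

variable [CharP F p]

lemma SmallBlocking.lineCard_eq (hB : SmallBlocking S r) {u : Fin 3 → F} (hu : u ≠ 0) :
    lineCard S r u = 1 + p * excess p S r u := by
  have h1 := hB.lineCard_pos hu
  have h2 : p ∣ lineCard S r u - 1 := by
    rw [← CharP.cast_eq_zero_iff F, Nat.cast_sub h1, hB.cast_lineCard hu]; simp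
  rw [excess, Nat.mul_div_cancel' h2]
  omega

lemma SmallBlocking.exists_card_eq (hB : SmallBlocking S r) :
    ∃ d, S.card = q + 1 + p * d := by
  have h1 := congrArg (Int.cast : ℤ → F) hB.sum_lineCard
  push_cast at h1
  rw [Nat.cast_card_eq_zero, ← Finset.add_sum_erase _ _ (Finset.mem_univ 0),
    Finset.sum_congr (s₁ := Finset.univ.erase 0) rfl
      (fun u hu => hB.cast_lineCard (Finset.ne_of_mem_erase hu)), lineCard_zero,
    Finset.sum_const, Finset.card_erase_of_mem (Finset.mem_univ _), Finset.card_univ,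
    nsmul_one, Nat.cast_sub Fintype.card_pos, Fintype.card_fun] at h1
  have h2 : (S.card : F) = 1 := by
    push_cast at h1
    rw [Nat.cast_card_eq_zero] at h1
    simp at h1
    linear_combination h1
  have h3 := hB.lt_card
  have h4 : p ∣ S.card - (q + 1) := by
    rw [← CharP.cast_eq_zero_iff F, Nat.cast_sub h3, h2]; simp
  obtain ⟨d, hd⟩ := h4
  exact ⟨d, by omega⟩

lemma SmallBlocking.excess_le (hB : SmallBlocking S r) {d : ℕ} (hp : 0 < p)
    (hcard : S.card = q + 1 + p * d) {u : Fin 3 → F} (hu : u ≠ 0) : excess p S r u ≤ d := by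
  have h1 := hB.lineCard_add_le hu
  rw [hB.lineCard_eq (p := p) hu] at h1
  exact Nat.le_of_mul_le_mul_left (by omega) hp

lemma SmallBlocking.sum_excess (hB : SmallBlocking S r) {d : ℕ} (hp : 0 < p)
    (hq : q = p ^ 3) (hcard : S.card = q + 1 + p * d) :
    ∑ u ∈ Finset.univ.erase (0 : Fin 3 → F), (excess p S r u : ℤ) * (excess p S r u - 1) =
      (p ^ 3 - 1) * (p ^ 2 * (p ^ 2 - 1) - d * (p ^ 3 - p ^ 2 + 1) + d ^ 2) := by
  have h1 := hB.sum_lineCard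
  have h2 := hB.sum_lineCard_sq
  rw [← Finset.add_sum_erase _ _ (Finset.mem_univ 0), lineCard_zero] at h1 h2
  have h3 : ∑ u ∈ Finset.univ.erase (0 : Fin 3 → F), (1 : ℤ) = q ^ 3 - 1 := by
    rw [Finset.sum_const, Finset.card_erase_of_mem (Finset.mem_univ _), Finset.card_univ,
      nsmul_one, Nat.cast_sub Fintype.card_pos, Fintype.card_fun]
    simp
  have hp' : (p : ℤ) ^ 2 ≠ 0 := by positivity
  refine mul_left_cancel₀ hp' ?_
  have h4 : (p : ℤ) ^ 2 * ∑ u ∈ Finset.univ.erase (0 : Fin 3 → F),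
      (excess p S r u : ℤ) * (excess p S r u - 1) =
      ∑ u ∈ Finset.univ.erase (0 : Fin 3 → F), (lineCard S r u : ℤ) ^ 2 -
        (p + 2) * ∑ u ∈ Finset.univ.erase (0 : Fin 3 → F), (lineCard S r u : ℤ) +
        (p + 1) * ∑ u ∈ Finset.univ.erase (0 : Fin 3 → F), (1 : ℤ) := by
    rw [Finset.mul_sum, Finset.mul_sum, Finset.mul_sum, ← Finset.sum_sub_distrib,
      ← Finset.sum_add_distrib]
    refine Finset.sum_congr rfl fun u hu => ?_
    rw [hB.lineCard_eq (p := p) (Finset.ne_of_mem_erase hu)]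
    push_cast
    ring
  have hb : (S.card : ℤ) = p ^ 3 + 1 + p * d := by rw [hcard, hq]; push_cast; ring
  have hq' : (q : ℤ) = p ^ 3 := by rw [hq]; push_cast; ring
  rw [h4, h3, eq_sub_of_add_eq' h1, eq_sub_of_add_eq' h2, hb, hq']
  ring

lemma SmallBlocking.le_succ (hB : SmallBlocking S r) {d : ℕ} (hp : p.Prime)
    (hq : q = p ^ 3) (hcard : S.card = q + 1 + p * d) :
    d ≤ p + 1 ∧ 2 * (p * d) ≤ p ^ 3 ∧ (p = 2 → d ≤ 2) := by
  have h1 : 2 * (p * d) ≤ p ^ 3 := by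
    have := hB.small
    rw [hcard, hq] at this
    omega
  have h2 := hB.sum_excess hp.pos hq hcard
  have h3 : (0 : ℤ) ≤ ∑ u ∈ Finset.univ.erase (0 : Fin 3 → F),
      (excess p S r u : ℤ) * (excess p S r u - 1) := Finset.sum_nonneg fun u _ => by
    rcases Nat.eq_zero_or_pos (excess p S r u) with h | h
    · rw [h]; simp
    · have : (1 : ℤ) ≤ excess p S r u := by exact_mod_cast h
      exact mul_nonneg (by omega) (by omega)
  rw [h2] at h3
  have hd2 : 2 * d ≤ p ^ 2 := Nat.le_of_mul_le_mul_left (by nlinarith) hp.pos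
  refine ⟨?_, h1, fun h => by rw [h] at hd2; omega⟩
  by_contra! h5
  have hp2 := hp.two_le
  have h6 : 5 ≤ p := by
    by_contra! h7
    interval_cases p
    · omega
    · omega
    · exact absurd hp (by norm_num)
  have h7 : (0 : ℤ) < (p : ℤ) ^ 3 - 1 := by
    have : (1 : ℤ) < (p : ℤ) ^ 3 := one_lt_pow₀ (by exact_mod_cast hp.one_lt) (by norm_num)
    omega
  have h8 := nonneg_of_mul_nonneg_right h3 h7
  have h9 : (p : ℤ) + 2 ≤ d := by exact_mod_cast h5
  have h10 : 2 * (d : ℤ) ≤ p ^ 2 := by exact_mod_cast hd2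
  have h11 : (5 : ℤ) ≤ p := by exact_mod_cast h6
  have h12 : (d : ℤ) + p + 2 - (p ^ 3 - p ^ 2 + 1) ≤ 0 := by nlinarith
  nlinarith [mul_nonneg (sub_nonneg.2 h9) (neg_nonneg.2 h12), mul_nonneg (sub_nonneg.2 h11) (sq_nonneg (p : ℤ))]

end Excess

section Wronskian

variable {F : Type*} [Field F] {p : ℕ} [Fact p.Prime] [CharP F p]

lemma exists_eq_C_mul_of_wronskian {a c : F[X]} {d : ℕ} (ha : a.natDegree ≤ d)
    (hc : c.natDegree ≤ d) (hcd : c.coeff d ≠ 0) (hdp : d < p)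
    (h : derivative a * c = a * derivative c) : ∃ e, a = C e * c := by
  refine ⟨a.coeff d / c.coeff d, ?_⟩
  rw [← sub_eq_zero]
  set b := a - C (a.coeff d / c.coeff d) * c with hb
  by_contra hb0
  have hbd : b.natDegree ≤ d :=
    (natDegree_sub_le _ _).trans (max_le ha ((natDegree_C_mul_le _ _).trans hc))
  have hbc : b.coeff d = 0 := by
    rw [hb, coeff_sub, coeff_C_mul, div_mul_cancel₀ _ hcd, sub_self]
  have hlt : b.natDegree < d := lt_of_le_of_ne hbd fun h0 => by
    rw [← h0, coeff_natDegree, leadingCoeff_eq_zero] at hbc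
    exact hb0 hbc
  have hw : (X * derivative b) * c = (X * derivative c) * b := by
    rw [hb, derivative_sub, derivative_C_mul]
    linear_combination X * h
  have hX : ∀ (f : F[X]) k, f.natDegree ≤ k → (X * derivative f).natDegree ≤ k := fun f k hf => by
    refine natDegree_le_iff_coeff_eq_zero.2 fun n hn => ?_
    obtain ⟨n, rfl⟩ := Nat.exists_eq_succ_of_ne_zero (by omega : n ≠ 0)
    rw [coeff_X_mul, coeff_derivative, coeff_eq_zero_of_natDegree_lt (by omega), zero_mul]
  have hXc : ∀ (f : F[X]) k, (X * derivative f).coeff k = f.coeff k * k := fun f k => by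
    cases k with
    | zero => simp
    | succ k => rw [coeff_X_mul, coeff_derivative]; push_cast; rfl
  have h1 := congrArg (fun f => coeff f (b.natDegree + d)) hw
  rw [coeff_mul_add_eq_of_natDegree_le (hX b _ le_rfl) hc, add_comm b.natDegree,
    coeff_mul_add_eq_of_natDegree_le (hX c _ hc) le_rfl, hXc, hXc, coeff_natDegree] at h1
  have h2 : ((d - b.natDegree : ℕ) : F) = 0 := by
    rw [Nat.cast_sub hlt.le]
    have h3 : b.leadingCoeff * c.coeff d * ((d : F) - b.natDegree) = 0 := by
      linear_combination -h1
    exact (mul_eq_zero.1 h3).resolve_left (mul_ne_zero (leadingCoeff_ne_zero.2 hb0) hcd)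
  rw [CharP.cast_eq_zero_iff F p] at h2
  exact absurd (Nat.le_of_dvd (by omega) h2) (by omega)

lemma prime_le_of_pencil [Fintype F] (hq : Fintype.card F = p ^ 3) {a c : F[X]} {d : ℕ}
    (ha : a.natDegree ≤ d) (hc : c.natDegree ≤ d) (hs : (X ^ p ^ 2 * c - a).Splits)
    (hdeg : (X ^ p ^ 2 * c - a).natDegree = p ^ 2 + d)
    (hm : ∀ m, (X ^ p ^ 2 * c - a).rootMultiplicity m ≤ d) : p ≤ d := by
  by_contra! hdp
  have hp := (Fact.out : p.Prime)
  have hp2 : p < p ^ 2 := by have := hp.two_le; nlinarith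
  set φ := X ^ p ^ 2 * c - a with hφ
  have hφ0 : φ ≠ 0 := fun h0 => by rw [h0] at hdeg; simp at hdeg; omega
  have hcd : c.coeff d ≠ 0 := by
    have h1 : φ.coeff (p ^ 2 + d) ≠ 0 := by
      rw [← hdeg, coeff_natDegree]; exact leadingCoeff_ne_zero.2 hφ0
    rwa [hφ, coeff_sub, add_comm, coeff_X_pow_mul,
      coeff_eq_zero_of_natDegree_lt (p := a) (by omega), sub_zero] at h1
  have hc0 : c ≠ 0 := fun h0 => by simp [h0] at hcd
  have hdφ : derivative φ = X ^ p ^ 2 * derivative c - derivative a := by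
    rw [hφ, derivative_sub, derivative_mul, derivative_X_pow]
    simp
  have hdvd : φ ∣ (X * c ^ p - a ^ p) * (derivative a * c - a * derivative c) := by
    refine dvd_of_splits_of_forall_pow_dvd hφ0 hs fun t => ?_
    rcases Nat.eq_zero_or_pos (φ.rootMultiplicity t) with h0 | h0
    · rw [h0, pow_zero]; exact one_dvd _
    rw [← Nat.sub_add_cancel h0, pow_succ, mul_comm]
    refine mul_dvd_mul ?_ ?_
    · rw [dvd_iff_isRoot, IsRoot]
      have h1 : φ.eval t = 0 := (rootMultiplicity_pos hφ0).1 h0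
      have h2 : (X * c ^ p - a ^ p).eval t = (φ.eval t) ^ p := by
        rw [hφ]
        simp only [eval_sub, eval_mul, eval_pow, eval_X]
        rw [sub_pow_char, mul_pow, ← pow_mul, ← pow_succ, ← hq, FiniteField.pow_card]
      rw [h2, h1, zero_pow hp.ne_zero]
    · have h1 : derivative a * c - a * derivative c = φ * derivative c - derivative φ * c := by
        rw [hdφ, hφ]; ring
      rw [h1]
      exact dvd_sub (((pow_dvd_pow _ (Nat.sub_le _ _)).trans
        (pow_rootMultiplicity_dvd φ t)).mul_right _)
        ((pow_sub_one_dvd_derivative_of_pow_dvd (pow_rootMultiplicity_dvd φ t)).mul_right _)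
  by_cases hw : derivative a * c - a * derivative c = 0
  · obtain ⟨e, he⟩ := exists_eq_C_mul_of_wronskian ha hc hcd hdp (sub_eq_zero.1 hw)
    have h1 : (X - C (e ^ p)) ^ p ^ 2 ∣ φ := by
      rw [sub_pow_char_pow, ← C_pow, ← pow_mul, ← pow_succ', ← hq, FiniteField.pow_card, hφ, he]
      exact ⟨c, by ring⟩
    have := ((le_rootMultiplicity_iff hφ0).2 h1).trans (hm _)
    omega
  · have h1 : X * c ^ p - a ^ p ≠ 0 := fun h0 => by
      have h2 := congrArg derivative h0
      rw [derivative_sub, derivative_mul, derivative_pow, derivative_pow] at h2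
      simp at h2
      exact hc0 h2.1
    have h2 := natDegree_le_of_dvd hdvd (mul_ne_zero h1 hw)
    have h3 : (X * c ^ p - a ^ p).natDegree ≤ 1 + p * d := by
      refine (natDegree_sub_le _ _).trans (max_le ?_ ?_)
      · refine natDegree_mul_le.trans (add_le_add natDegree_X_le (natDegree_pow_le.trans ?_))
        exact Nat.mul_le_mul_left _ hc
      · exact natDegree_pow_le.trans ((Nat.mul_le_mul_left _ ha).trans (by omega))
    have h4 : (derivative a * c - a * derivative c).natDegree ≤ d - 1 + d := by
      refine (natDegree_sub_le _ _).trans (max_le ?_ ?_)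
      · exact natDegree_mul_le.trans (add_le_add ((natDegree_derivative_le _).trans (by omega)) hc)
      · rw [add_comm]
        exact natDegree_mul_le.trans (add_le_add ha ((natDegree_derivative_le _).trans (by omega)))
    have h5 := h2.trans (natDegree_mul_le.trans (add_le_add h3 h4))
    rw [hdeg] at h5
    have h6 : p * d + p ≤ p ^ 2 := by nlinarith
    have := hp.two_le
    omega

end Wronskian

section RootRelations

variable {F : Type*} [Field F] {p : ℕ}

lemma coeff_eq_zero_of_sum_eq_zero {s t : ℕ} (hs : s ≤ p) (e : ℕ → ℕ → F) {N : Finset F}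
    (hN : s - 1 + p * (t - 1) < N.card)
    (h : ∀ x ∈ N, ∑ i ∈ Finset.range s, ∑ k ∈ Finset.range t, e i k * (x ^ i * (x ^ p) ^ k) = 0)
    {i k : ℕ} (hi : i < s) (hk : k < t) : e i k = 0 := by
  set P : F[X] := ∑ i ∈ Finset.range s, ∑ k ∈ Finset.range t, C (e i k) * X ^ (i + p * k) with hP
  have hdeg : P.natDegree ≤ s - 1 + p * (t - 1) := by
    refine natDegree_sum_le_of_forall_le _ _ fun i hi => natDegree_sum_le_of_forall_le _ _
      fun k hk => (natDegree_C_mul_X_pow_le _ _).trans ?_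
    rw [Finset.mem_range] at hi hk
    exact add_le_add (by omega) (Nat.mul_le_mul_left _ (by omega))
  have hP0 : P = 0 := by
    refine eq_zero_of_natDegree_lt_card_of_eval_eq_zero' P N (fun x hx => ?_) (by omega)
    rw [hP, ← h x hx]
    simp only [eval_finsetSum, eval_mul, eval_C, eval_pow, eval_X, pow_add, pow_mul]
  have h1 := congrArg (fun f => coeff f (i + p * k)) hP0
  simp only [hP, finsetSum_coeff, coeff_C_mul_X_pow, coeff_zero] at h1
  rw [Finset.sum_eq_single i, Finset.sum_eq_single k] at h1
  · simpa using h1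
  · intro k' _ hk'
    rw [if_neg]
    intro h2
    exact hk' (Nat.eq_of_mul_eq_mul_left (by omega : 0 < p) (by omega)).symm
  · intro h2; exact absurd (Finset.mem_range.2 hk) h2
  · intro i' hi' hii'
    refine Finset.sum_eq_zero fun k' _ => if_neg fun h2 => hii' ?_
    have h3 := congrArg (· % p) h2
    rw [Finset.mem_range] at hi'
    simp only [Nat.add_mul_mod_self_left] at h3
    rw [Nat.mod_eq_of_lt (by omega), Nat.mod_eq_of_lt (by omega)] at h3
    exact h3.symm
  · intro h2; exact absurd (Finset.mem_range.2 hi) h2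

lemma bilinear_eq_zero (hp : 2 ≤ p) {e₀₀ e₁₀ e₀₁ e₁₁ : F} {N : Finset F} (hN : p + 1 < N.card)
    (h : ∀ x ∈ N, e₀₀ + e₁₀ * x + e₀₁ * x ^ p + e₁₁ * x * x ^ p = 0) :
    e₀₀ = 0 ∧ e₁₀ = 0 ∧ e₀₁ = 0 ∧ e₁₁ = 0 := by
  have h1 := fun i k (hi : i < 2) (hk : k < 2) => coeff_eq_zero_of_sum_eq_zero (p := p) hp
    (fun i k => ([[e₀₀, e₀₁], [e₁₀, e₁₁]].getD i []).getD k 0) (N := N) (t := 2)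
    (by omega) (fun x hx => by
      rw [← h x hx]; simp [Finset.sum_range_succ]; ring) hi hk
  exact ⟨h1 0 0 (by omega) (by omega), h1 1 0 (by omega) (by omega), h1 0 1 (by omega) (by omega),
    h1 1 1 (by omega) (by omega)⟩

lemma biquadratic_eq_zero (hp : 3 ≤ p) {e₀₀ e₁₀ e₂₀ e₀₁ e₁₁ e₂₁ e₀₂ e₁₂ e₂₂ : F} {N : Finset F}
    (hN : 2 * p + 2 < N.card)
    (h : ∀ x ∈ N, e₀₀ + e₁₀ * x + e₂₀ * x ^ 2 + (e₀₁ + e₁₁ * x + e₂₁ * x ^ 2) * x ^ p +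
      (e₀₂ + e₁₂ * x + e₂₂ * x ^ 2) * (x ^ p) ^ 2 = 0) :
    (e₀₀ = 0 ∧ e₁₀ = 0 ∧ e₂₀ = 0) ∧ (e₀₁ = 0 ∧ e₁₁ = 0 ∧ e₂₁ = 0) ∧
      e₀₂ = 0 ∧ e₁₂ = 0 ∧ e₂₂ = 0 := by
  have h1 := fun i k (hi : i < 3) (hk : k < 3) => coeff_eq_zero_of_sum_eq_zero (p := p) hp
    (fun i k => ([[e₀₀, e₀₁, e₀₂], [e₁₀, e₁₁, e₁₂], [e₂₀, e₂₁, e₂₂]].getD i []).getD k 0) (N := N) (t := 3)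
    (by omega) (fun x hx => by
      rw [← h x hx]; simp [Finset.sum_range_succ]; ring) hi hk
  exact ⟨⟨h1 0 0 (by omega) (by omega), h1 1 0 (by omega) (by omega), h1 2 0 (by omega) (by omega)⟩,
    ⟨h1 0 1 (by omega) (by omega), h1 1 1 (by omega) (by omega), h1 2 1 (by omega) (by omega)⟩,
    h1 0 2 (by omega) (by omega), h1 1 2 (by omega) (by omega), h1 2 2 (by omega) (by omega)⟩

variable [Fact p.Prime] [CharP F p]

lemma pow_pow_sq [Fintype F] (hq : Fintype.card F = p ^ 3) (x : F) : (x ^ p ^ 2) ^ p = x := by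
  rw [← pow_mul, ← pow_succ, ← hq, FiniteField.pow_card]

lemma exists_linear_relation [Fintype F] (hq : Fintype.card F = p ^ 3) {I : Finset ℕ}
    {A C W W' : ℕ → F} {N : Finset F} (hN : p + 1 < N.card)
    (h : ∀ x ∈ N, ∃ s : F, s ≠ 0 ∧ ∀ i ∈ I, A i - x ^ p ^ 2 * C i = s * (W i - x * W' i)) :
    ∃ α β : F, (α ≠ 0 ∨ β ≠ 0) ∧ ∀ i ∈ I, α * W i + β * W' i = 0 := by
  have hp := (Fact.out : p.Prime)
  by_cases hminor : ∀ i ∈ I, ∀ k ∈ I, W i * W' k - W' i * W k = 0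
  · by_cases h0 : ∃ k ∈ I, W' k ≠ 0 ∨ - W k ≠ 0
    · obtain ⟨k, hk, h1⟩ := h0
      exact ⟨W' k, - W k, h1, fun i hi => by linear_combination hminor i hi k hk⟩
    · push Not at h0
      exact ⟨1, 0, Or.inl one_ne_zero, fun i hi => by
        rw [neg_eq_zero.1 (h0 i hi).2]; ring⟩
  · exfalso
    push Not at hminor
    obtain ⟨i, hi, k, hk, hik⟩ := hminor
    have h1 : ∀ x ∈ N, (A i * W k - A k * W i) ^ p + (-(C i * W k - C k * W i) ^ p) * x +
        (-(A i * W' k - A k * W' i) ^ p) * x ^ p + (C i * W' k - C k * W' i) ^ p * x * x ^ p = 0 := by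
      intro x hx
      obtain ⟨s, -, hs⟩ := h x hx
      have h2 : (A i - x ^ p ^ 2 * C i) * (W k - x * W' k) - (A k - x ^ p ^ 2 * C k) * (W i - x * W' i) = 0 := by
        rw [hs i hi, hs k hk]; ring
      have h3 := congrArg (· ^ p) h2
      simp only [sub_pow_char, mul_pow, pow_pow_sq hq, zero_pow hp.ne_zero] at h3 ⊢
      linear_combination h3
    obtain ⟨e1, e2, e3, e4⟩ := bilinear_eq_zero hp.two_le hN h1
    rw [neg_eq_zero] at e2 e3
    rw [pow_eq_zero_iff hp.ne_zero] at e1 e2 e3 e4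
    have a1 : A i = 0 := (mul_eq_zero.1 (by linear_combination W i * e3 - W' i * e1 :
      A i * (W i * W' k - W' i * W k) = 0)).resolve_right hik
    have a2 : A k = 0 := (mul_eq_zero.1 (by linear_combination W k * e3 - W' k * e1 :
      A k * (W i * W' k - W' i * W k) = 0)).resolve_right hik
    have c1 : C i = 0 := (mul_eq_zero.1 (by linear_combination W i * e4 - W' i * e2 :
      C i * (W i * W' k - W' i * W k) = 0)).resolve_right hik
    have c2 : C k = 0 := (mul_eq_zero.1 (by linear_combination W k * e4 - W' k * e2 :
      C k * (W i * W' k - W' i * W k) = 0)).resolve_right hik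
    obtain ⟨x, hx⟩ := Finset.card_pos.1 (by omega : 0 < N.card)
    obtain ⟨s, hs0, hs⟩ := h x hx
    have h5 := hs i hi
    have h6 := hs k hk
    rw [a1, c1] at h5
    rw [a2, c2] at h6
    simp [hs0] at h5 h6
    exact hik (by linear_combination W' k * (h5) - W' i * (h6))

end RootRelations

section RootRelations

variable {F : Type*} [Field F] {p : ℕ} [Fact p.Prime] [CharP F p]

lemma coeff_relations_of_pow_dvd {E : F[X]} (hE : E.natDegree ≤ p + 1) {x : F}
    (h : (X - C x) ^ p ∣ E) : (∀ i, 2 ≤ i → i < p → E.coeff i = 0) ∧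
      E.coeff 0 + x ^ p * E.coeff p = 0 ∧ E.coeff 1 + x ^ p * E.coeff (p + 1) = 0 := by
  have hp := (Fact.out : p.Prime)
  have hp2 := hp.two_le
  obtain ⟨Q, hQ⟩ := h
  rw [sub_pow_char, ← C_pow] at hQ
  have hdeg : ∀ n, 2 ≤ n → Q.coeff n = 0 := fun n hn => by
    refine coeff_eq_zero_of_natDegree_lt ?_
    by_cases hQ0 : Q = 0
    · rw [hQ0, natDegree_zero]; omega
    · have h1 := congrArg natDegree hQ
      rw [natDegree_mul (X_pow_sub_C_ne_zero hp.pos _) hQ0, natDegree_X_pow_sub_C] at h1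
      omega
  have hco : ∀ n, E.coeff n = (if p ≤ n then Q.coeff (n - p) else 0) - x ^ p * Q.coeff n :=
    fun n => by rw [hQ, sub_mul, coeff_sub, coeff_X_pow_mul', coeff_C_mul]
  refine ⟨fun i hi hip => ?_, ?_, ?_⟩
  · rw [hco, hdeg i hi, if_neg (by omega)]; ring
  · rw [hco, hco, if_neg (by omega), if_pos le_rfl, Nat.sub_self, hdeg p hp2]; ring
  · rw [hco, hco, if_neg (by omega), if_pos (by omega), Nat.add_sub_cancel_left,
      hdeg (p + 1) (by omega)]; ring

/-- The relation satisfied at a simple root `x` of `X ^ p ^ 2 * c - a`. -/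
def SimpleRootRel (p : ℕ) (a c ω : F[X]) (x : F) : Prop :=
  ∃ s : F, s ≠ 0 ∧ (X - C x) ^ p ∣ a - C (x ^ p ^ 2) * c - C s * ((X - C x) * ω)

lemma SimpleRootRel.exists_coeff {a c ω : F[X]} (ha : a.natDegree ≤ p + 1)
    (hc : c.natDegree ≤ p + 1) (hω : ω.natDegree ≤ p) {x : F} (h : SimpleRootRel p a c ω x) :
    ∃ s : F, s ≠ 0 ∧
      (∀ i, 2 ≤ i → i < p → a.coeff i - x ^ p ^ 2 * c.coeff i =
        s * (ω.coeff (i - 1) - x * ω.coeff i)) ∧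
      a.coeff 0 + x ^ p * a.coeff p - x ^ p ^ 2 * (c.coeff 0 + x ^ p * c.coeff p) =
        s * (-(x * ω.coeff 0) + x ^ p * (ω.coeff (p - 1) - x * ω.coeff p)) ∧
      a.coeff 1 + x ^ p * a.coeff (p + 1) - x ^ p ^ 2 * (c.coeff 1 + x ^ p * c.coeff (p + 1)) =
        s * (ω.coeff 0 - x * ω.coeff 1 + x ^ p * ω.coeff p) := by
  have hp := (Fact.out : p.Prime)
  obtain ⟨s, hs, hdvd⟩ := h
  have hdeg : (a - C (x ^ p ^ 2) * c - C s * ((X - C x) * ω)).natDegree ≤ p + 1 := by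
    refine (natDegree_sub_le _ _).trans (max_le ((natDegree_sub_le _ _).trans (max_le ha
      ((natDegree_C_mul_le _ _).trans hc))) ((natDegree_C_mul_le _ _).trans
      (natDegree_mul_le.trans ?_)))
    rw [natDegree_X_sub_C]; omega
  obtain ⟨h1, h2, h3⟩ := coeff_relations_of_pow_dvd hdeg hdvd
  have hco : ∀ n, (a - C (x ^ p ^ 2) * c - C s * ((X - C x) * ω)).coeff (n + 1) =
      a.coeff (n + 1) - x ^ p ^ 2 * c.coeff (n + 1) - s * (ω.coeff n - x * ω.coeff (n + 1)) :=
    fun n => by simp only [coeff_sub, coeff_C_mul, sub_mul, coeff_X_mul]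
  have hco0 : (a - C (x ^ p ^ 2) * c - C s * ((X - C x) * ω)).coeff 0 =
      a.coeff 0 - x ^ p ^ 2 * c.coeff 0 - s * (- (x * ω.coeff 0)) := by
    simp only [coeff_sub, sub_mul, mul_coeff_zero, coeff_X_zero, coeff_C_zero, zero_mul, zero_sub]
  have hcop := hco (p - 1)
  rw [Nat.sub_add_cancel hp.one_le] at hcop
  have hωp : ω.coeff (p + 1) = 0 := coeff_eq_zero_of_natDegree_lt (by omega)
  refine ⟨s, hs, fun i hi hip => ?_, ?_, ?_⟩
  · obtain ⟨i, rfl⟩ := Nat.exists_eq_succ_of_ne_zero (by omega : i ≠ 0)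
    have h4 := h1 _ hi hip
    rw [hco] at h4
    rw [Nat.succ_sub_one]
    linear_combination h4
  · rw [hco0, hcop] at h2
    linear_combination h2
  · rw [hco 0, hco p, hωp] at h3
    rw [zero_add] at h3
    linear_combination h3

lemma eq_zero_of_forall_sub_mul {N : Finset F} [Fintype F] (hN : 1 < N.card) {A B : F}
    (h : ∀ x ∈ N, A - x ^ p ^ 2 * B = 0) : A = 0 ∧ B = 0 := by
  obtain ⟨x, hx, y, hy, hxy⟩ := Finset.one_lt_card.1 hN
  have hB : B = 0 := by
    have h1 : (x - y) ^ p ^ 2 * B = 0 := by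
      rw [sub_pow_char_pow]; linear_combination h y hy - h x hx
    exact (mul_eq_zero.1 h1).resolve_left (pow_ne_zero _ (sub_ne_zero.2 hxy))
  refine ⟨?_, hB⟩
  have := h x hx
  rwa [hB, mul_zero, sub_zero] at this

/-- A polynomial of degree at most `p` whose middle coefficients satisfy a two-term recurrence. -/
lemma linear_mul_eq_four_terms {f : F[X]} (hf : f.natDegree ≤ p) {α β : F}
    (h : ∀ i, 2 ≤ i → i < p → α * f.coeff (i - 1) + β * f.coeff i = 0) :
    (C α * X + C β) * f = C (β * f.coeff 0) + C (α * f.coeff 0 + β * f.coeff 1) * X +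
      C (α * f.coeff (p - 1) + β * f.coeff p) * X ^ p + C (α * f.coeff p) * X ^ (p + 1) := by
  have hp := (Fact.out : p.Prime)
  have hp2 := hp.two_le
  ext n
  rcases n with _ | n
  · simp [mul_coeff_zero, coeff_X_pow, hp.ne_zero, hp.ne_zero.symm]
  · simp only [add_mul, mul_assoc, coeff_add, coeff_C_mul, coeff_X_mul, coeff_X_pow, coeff_C_succ,
      coeff_X]
    by_cases h2 : n = 0
    · subst h2
      simp [hp.ne_zero, hp.ne_one.symm]
    · by_cases h3 : n + 1 < p
      · have := h (n + 1) (by omega) h3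
        rw [Nat.add_sub_cancel] at this
        rw [this, if_neg (by omega), if_neg (by omega), if_neg (by omega)]
        ring
      · by_cases h4 : n + 1 = p
        · subst h4
          simp [h2]
        · by_cases h5 : n = p
          · subst h5
            rw [coeff_eq_zero_of_natDegree_lt (n := n + 1) (by omega)]
            simp [h2]
          · rw [coeff_eq_zero_of_natDegree_lt (n := n + 1) (by omega),
              coeff_eq_zero_of_natDegree_lt (n := n) (by omega), if_neg (by omega),
              if_neg (by omega), if_neg (by omega)]
            ring

lemma mul_eq_four_terms {f : F[X]} (hf : f.natDegree ≤ p) {α β : F}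
    (h : ∀ i, 2 ≤ i → i < p → α * f.coeff (i - 1) + β * f.coeff i = 0) (x : F) :
    (α * x + β) * f.eval x = β * f.coeff 0 + (α * f.coeff 0 + β * f.coeff 1) * x +
      (α * f.coeff (p - 1) + β * f.coeff p) * x ^ p + α * f.coeff p * x * x ^ p := by
  have h2 := congrArg (eval x) (linear_mul_eq_four_terms hf h)
  simp only [eval_mul, eval_add, eval_C, eval_X, eval_pow] at h2
  rw [h2]; ring

lemma coeff_eq_zero_of_elimination [Fintype F] (hq : Fintype.card F = p ^ 3) (hp3 : 3 ≤ p)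
    {C₀ C₁ C₂ C₃ A₂ A₃ : F} {N : Finset F} (hN : 2 * p + 2 < N.card)
    (h : ∀ x ∈ N, x ^ p ^ 2 * (C₀ + C₁ * x + C₂ * x ^ p + C₃ * x * x ^ p) =
      A₂ * x ^ p + A₃ * x * x ^ p) : A₂ = 0 := by
  have hp := (Fact.out : p.Prime)
  have hp2 : ∀ x : F, (x ^ p) ^ p = x ^ p ^ 2 := fun x => by rw [← pow_mul, pow_two]
  obtain ⟨-, ⟨h1, -, -⟩, -⟩ := biquadratic_eq_zero hp3 (N := N) hN (e₀₀ := 0)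
    (e₁₀ := C₀ ^ p * C₀) (e₂₀ := C₀ ^ p * C₁) (e₀₁ := - A₂ ^ (p + 1))
    (e₁₁ := C₀ ^ p * C₂ + C₁ ^ p * C₀ + C₂ ^ p * A₂ - A₂ ^ p * A₃)
    (e₂₁ := C₀ ^ p * C₃ + C₁ ^ p * C₁ + C₂ ^ p * A₃) (e₀₂ := - A₃ ^ p * A₂)
    (e₁₂ := C₁ ^ p * C₂ + C₃ ^ p * A₂ - A₃ ^ p * A₃) (e₂₂ := C₁ ^ p * C₃ + C₃ ^ p * A₃)
    (fun x hx => by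
      have h1 := h x hx
      have h2 := congrArg (· ^ p) h1
      simp only [add_pow_char, mul_pow, pow_pow_sq hq, hp2] at h2
      linear_combination (C₀ + C₁ * x + C₂ * x ^ p + C₃ * x * x ^ p) * h2 -
        (C₂ ^ p * x + C₃ ^ p * x * x ^ p - A₂ ^ p - A₃ ^ p * x ^ p) * h1)
  exact (pow_eq_zero_iff (by omega)).1 (neg_eq_zero.1 h1)

end RootRelations

section DegreeP

variable {F : Type*} [Field F] [Fintype F] {p : ℕ} [Fact p.Prime] [CharP F p]

lemma root_eq (a c : F[X]) {x : F} (h : (X ^ p ^ 2 * c - a).eval x = 0) :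
    x ^ p ^ 2 * c.eval x = a.eval x := by
  simpa [sub_eq_zero] using h

lemma X_pow_dvd_of_degree_eq_prime (hq : Fintype.card F = p ^ 3) (hp3 : 3 ≤ p) {a c ω : F[X]}
    (ha : a.natDegree ≤ p) (hc : c.natDegree ≤ p) (hω : ω.natDegree ≤ p - 1) {N N₁ : Finset F}
    (hN : 2 * p + 2 < N.card) (hN₁ : p + 1 < N₁.card)
    (hroot : ∀ x ∈ N, (X ^ p ^ 2 * c - a).eval x = 0)
    (hrel : ∀ x ∈ N₁, SimpleRootRel p a c ω x) (h0 : X ^ 2 ∣ a) : X ^ p ∣ a := by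
  have hp := (Fact.out : p.Prime)
  rw [X_pow_dvd_iff] at h0 ⊢
  have a0 := h0 0 (by omega)
  have a1 := h0 1 (by omega)
  have hap : a.coeff (p + 1) = 0 := coeff_eq_zero_of_natDegree_lt (by omega)
  have hcp : c.coeff (p + 1) = 0 := coeff_eq_zero_of_natDegree_lt (by omega)
  have hωp : ω.coeff p = 0 := coeff_eq_zero_of_natDegree_lt (by omega)
  have hmid : ∀ x ∈ N₁, ∃ s : F, s ≠ 0 ∧ ∀ i ∈ Finset.Ico 1 p,
      a.coeff i - x ^ p ^ 2 * c.coeff i = s * (ω.coeff (i - 1) - x * ω.coeff i) := fun x hx => by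
    obtain ⟨s, hs, h1, -, h2⟩ := (hrel x hx).exists_coeff (by omega) (by omega) (by omega)
    refine ⟨s, hs, fun i hi => ?_⟩
    rw [Finset.mem_Ico] at hi
    by_cases hi1 : i = 1
    · subst hi1
      rw [hap, hcp, hωp] at h2
      rw [Nat.sub_self]
      linear_combination h2
    · exact h1 i (by omega) hi.2
  obtain ⟨α, β, hαβ, hW⟩ := exists_linear_relation (W := fun i => ω.coeff (i - 1))
    (W' := fun i => ω.coeff i) hq hN₁ hmid
  have hcomb : ∀ i, 2 ≤ i → i < p → α * a.coeff (i - 1) + β * a.coeff i = 0 ∧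
      α * c.coeff (i - 1) + β * c.coeff i = 0 := fun i hi hip => by
    refine eq_zero_of_forall_sub_mul (p := p) (N := N₁) (by omega) fun x hx => ?_
    obtain ⟨s, -, hs⟩ := hmid x hx
    have h1 := hs (i - 1) (Finset.mem_Ico.2 ⟨by omega, by omega⟩)
    have h2 := hs i (Finset.mem_Ico.2 ⟨by omega, by omega⟩)
    have h3 := hW (i - 1) (Finset.mem_Ico.2 ⟨by omega, by omega⟩)
    have h4 := hW i (Finset.mem_Ico.2 ⟨by omega, by omega⟩)
    linear_combination α * h1 + β * h2 + s * h3 - s * x * h4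
  have hA₂ := coeff_eq_zero_of_elimination (p := p) hq hp3 (N := N) hN (fun x hx => by
    have h1 := mul_eq_four_terms ha (fun i hi hip => (hcomb i hi hip).1) x
    have h2 := mul_eq_four_terms hc (fun i hi hip => (hcomb i hi hip).2) x
    rw [← root_eq a c (hroot x hx), a0, a1] at h1
    have h3 : x ^ p ^ 2 * ((α * x + β) * c.eval x) = (α * a.coeff (p - 1) + β * a.coeff p) * x ^ p +
      α * a.coeff p * x * x ^ p := by linear_combination h1
    rw [h2] at h3
    exact h3)
  have hrec : ∀ i, 1 ≤ i → i ≤ p → α * a.coeff (i - 1) + β * a.coeff i = 0 := fun i hi hip => by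
    rcases eq_or_lt_of_le hip with h1 | h1
    · rw [h1]; exact hA₂
    · by_cases h2 : i = 1
      · rw [h2, Nat.sub_self, a0, a1]; ring
      · exact (hcomb i (by omega) h1).1
  by_cases hβ : β = 0
  · intro i hi
    have h1 := hrec (i + 1) (by omega) (by omega)
    rw [hβ, zero_mul, add_zero, Nat.add_sub_cancel] at h1
    exact (mul_eq_zero.1 h1).resolve_left (hαβ.resolve_right (not_not.2 hβ))
  · intro i hi
    induction i with
    | zero => exact a0
    | succ i ih =>
      have h1 := hrec (i + 1) (by omega) (by omega)
      rw [Nat.add_sub_cancel, ih (by omega), mul_zero, zero_add] at h1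
      exact (mul_eq_zero.1 h1).resolve_left hβ

end DegreeP

section DegreePAddOne

variable {F : Type*} [Field F] [Fintype F] {p : ℕ} [Fact p.Prime] [CharP F p]

/-- The case in which the middle coefficients of `ω` vanish. -/
lemma X_pow_dvd_of_coeff_eq_zero (hq : Fintype.card F = p ^ 3) (hp3 : 3 ≤ p) {a c ω : F[X]}
    (ha : a.natDegree ≤ p + 1) (hc : c.natDegree ≤ p + 1) (hω : ω.natDegree ≤ p)
    {N N₁ : Finset F} (hN : 2 * p + 2 < N.card) (hN₁ : 1 < N₁.card)
    (hroot : ∀ x ∈ N, (X ^ p ^ 2 * c - a).eval x = 0)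
    (hrel : ∀ x ∈ N₁, SimpleRootRel p a c ω x) (h0 : X ^ 2 ∣ a)
    (hW : ∀ i, 1 ≤ i → i < p → ω.coeff i = 0) : X ^ (p + 1) ∣ a := by
  have hp := (Fact.out : p.Prime)
  rw [X_pow_dvd_iff] at h0 ⊢
  have a0 := h0 0 (by omega)
  have a1 := h0 1 (by omega)
  have hmid : ∀ i, 2 ≤ i → i < p → a.coeff i = 0 ∧ c.coeff i = 0 := fun i hi hip => by
    refine eq_zero_of_forall_sub_mul (p := p) hN₁ fun x hx => ?_
    obtain ⟨s, -, hs, -⟩ := (hrel x hx).exists_coeff ha hc hω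
    rw [hs i hi hip, hW i (by omega) hip, hW (i - 1) (by omega) (by omega)]
    ring
  have hfour : ∀ f : F[X], f.natDegree ≤ p + 1 → (∀ i, 2 ≤ i → i < p → f.coeff i = 0) → ∀ x,
      f.eval x = f.coeff 0 + f.coeff 1 * x + f.coeff p * x ^ p + f.coeff (p + 1) * x * x ^ p := by
    intro f hf hf0 x
    have h1 : f = C (f.coeff 0) + C (f.coeff 1) * X + C (f.coeff p) * X ^ p +
        C (f.coeff (p + 1)) * X ^ (p + 1) := by
      ext n
      simp only [coeff_add, coeff_C_mul, coeff_X_pow, coeff_X, coeff_C]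
      rcases lt_or_ge n 2 with h2 | h2
      · interval_cases n
        · simp [hp.ne_zero.symm]
        · simp [hp.ne_one.symm, hp.ne_zero]
      · rw [if_neg (by omega : n ≠ 0), if_neg (by omega : ¬ 1 = n)]
        rcases lt_or_ge n p with h3 | h3
        · rw [hf0 n h2 h3, if_neg (by omega), if_neg (by omega)]; simp
        · rcases eq_or_lt_of_le h3 with rfl | h4
          · simp
          · rcases eq_or_lt_of_le (Nat.succ_le_of_lt h4) with h5 | h5
            · rw [Nat.succ_eq_add_one] at h5
              rw [← h5]; simp
            · rw [coeff_eq_zero_of_natDegree_lt (by omega), if_neg (by omega), if_neg (by omega)]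
              simp
    conv_lhs => rw [h1]
    simp only [eval_add, eval_mul, eval_C, eval_X, eval_pow]
    ring
  have hap := coeff_eq_zero_of_elimination (p := p) hq hp3 (N := N) hN (fun x hx => by
    have h1 := root_eq a c (hroot x hx)
    rw [hfour a ha (fun i hi hip => (hmid i hi hip).1), a0, a1,
      hfour c hc (fun i hi hip => (hmid i hi hip).2), zero_mul, zero_add, zero_add] at h1
    exact h1)
  intro i hi
  rcases lt_or_ge i 2 with h2 | h2
  · exact h0 i h2
  · rcases lt_or_ge i p with h3 | h3
    · exact (hmid i h2 h3).1
    · rw [show i = p by omega]; exact hap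

lemma coeff_eq_zero_of_coeff_one_ne_zero (hq : Fintype.card F = p ^ 3) (hp3 : 3 ≤ p)
    {a c ω : F[X]} (ha : a.natDegree ≤ p + 1) (hc : c.natDegree ≤ p + 1) (hω : ω.natDegree ≤ p)
    {N : Finset F} (hN : 2 * p + 2 < N.card) (hrel : ∀ x ∈ N, SimpleRootRel p a c ω x)
    (hW : ∀ i, 2 ≤ i → i < p → ω.coeff i = 0) (hκ : ω.coeff 1 ≠ 0) : c.coeff (p + 1) = 0 := by
  have hp := (Fact.out : p.Prime)
  have hp2 : ∀ x : F, (x ^ p) ^ p = x ^ p ^ 2 := fun x => by rw [← pow_mul, pow_two]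
  set κ := ω.coeff 1
  set ε := c.coeff 2
  set ε' := a.coeff 2
  have hS : ∀ x ∈ N, ∃ s : F, s ≠ 0 ∧ ε' - x ^ p ^ 2 * ε = s * κ ∧
      a.coeff 1 + x ^ p * a.coeff (p + 1) - x ^ p ^ 2 * (c.coeff 1 + x ^ p * c.coeff (p + 1)) =
        s * (ω.coeff 0 - x * κ + x ^ p * ω.coeff p) := fun x hx => by
    obtain ⟨s, hs, h1, -, h2⟩ := (hrel x hx).exists_coeff ha hc hω
    refine ⟨s, hs, ?_, h2⟩
    rw [h1 2 le_rfl (by omega), hW 2 le_rfl (by omega)]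
    ring
  obtain ⟨A₀, hA₀⟩ : ∃ t, t = ε * ω.coeff 0 - κ * c.coeff 1 := ⟨_, rfl⟩
  obtain ⟨A₁, hA₁⟩ : ∃ t, t = ε * ω.coeff p - κ * c.coeff (p + 1) := ⟨_, rfl⟩
  obtain ⟨B₀, hB₀⟩ : ∃ t, t = ε' * ω.coeff 0 - κ * a.coeff 1 := ⟨_, rfl⟩
  obtain ⟨B₁, hB₁⟩ : ∃ t, t = ε' * ω.coeff p - κ * a.coeff (p + 1) := ⟨_, rfl⟩
  have hz : ∀ x ∈ N, x ^ p ^ 2 * (A₀ + A₁ * x ^ p - ε * κ * x) =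
      B₀ + B₁ * x ^ p - ε' * κ * x := fun x hx => by
    obtain ⟨s, -, h1, h2⟩ := hS x hx
    rw [hA₀, hA₁, hB₀, hB₁]
    linear_combination κ * h2 - (ω.coeff 0 - x * κ + x ^ p * ω.coeff p) * h1
  obtain ⟨-, ⟨-, -, e21⟩, e02, -, -⟩ := biquadratic_eq_zero hp3 (N := N) hN
    (e₀₀ := - B₀ * B₁ ^ p - A₀ * B₀ ^ p)
    (e₁₀ := B₀ * A₁ ^ p + ε' * κ * B₁ ^ p + A₀ * A₀ ^ p + ε * κ * B₀ ^ p)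
    (e₂₀ := - (ε' * κ) * A₁ ^ p - ε * κ * A₀ ^ p)
    (e₀₁ := - B₁ * B₁ ^ p + A₀ * (ε' * κ) ^ p - A₁ * B₀ ^ p)
    (e₁₁ := B₁ * A₁ ^ p - A₀ * (ε * κ) ^ p + A₁ * A₀ ^ p - ε * κ * (ε' * κ) ^ p)
    (e₂₁ := (ε * κ) * (ε * κ) ^ p) (e₀₂ := A₁ * (ε' * κ) ^ p) (e₁₂ := - A₁ * (ε * κ) ^ p) (e₂₂ := 0)
    (fun x hx => by
      have h1 := hz x hx
      have h2 := congrArg (· ^ p) h1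
      simp only [sub_pow_char, add_pow_char, mul_pow, pow_pow_sq hq, hp2] at h2
      simp only [mul_pow]
      linear_combination -(A₁ ^ p * x - B₁ ^ p) * h1 + (A₀ + A₁ * x ^ p - ε * κ * x) * h2)
  have hε : ε = 0 := by
    rw [← pow_succ', pow_eq_zero_iff (by omega)] at e21
    exact (mul_eq_zero.1 e21).resolve_right hκ
  obtain ⟨x, hx⟩ := Finset.card_pos.1 (by omega : 0 < N.card)
  obtain ⟨s, hs, h1, -⟩ := hS x hx
  rw [hε, mul_zero, sub_zero] at h1
  have hε' : ε' ≠ 0 := h1 ▸ mul_ne_zero hs hκ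
  have h2 := (mul_eq_zero.1 e02).resolve_right (pow_ne_zero _ (mul_ne_zero hε' hκ))
  rw [hA₁, hε, zero_mul, zero_sub, neg_eq_zero] at h2
  exact (mul_eq_zero.1 h2).resolve_left hκ

lemma X_pow_dvd_of_coeff_pred_ne_zero (hq : Fintype.card F = p ^ 3) (hp3 : 3 ≤ p)
    {a c ω : F[X]} (ha : a.natDegree ≤ p + 1) (hc : c.natDegree ≤ p + 1) (hω : ω.natDegree ≤ p)
    {N : Finset F} (hN : 2 * p + 2 < N.card) (hrel : ∀ x ∈ N, SimpleRootRel p a c ω x)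
    (hN0 : 0 ∉ N) (hW : ∀ i, 1 ≤ i → i < p - 1 → ω.coeff i = 0) (hκ : ω.coeff (p - 1) ≠ 0) :
    X ^ p ∣ a ∧ N.card ≤ p ^ 2 := by
  have hp := (Fact.out : p.Prime)
  have hp2 : ∀ x : F, (x ^ p) ^ p = x ^ p ^ 2 := fun x => by rw [← pow_mul, pow_two]
  set κ := ω.coeff (p - 1)
  set ε := c.coeff (p - 1)
  set ε' := a.coeff (p - 1)
  have hmid : ∀ i, 2 ≤ i → i < p - 1 → a.coeff i = 0 := fun i hi hip => by
    refine (eq_zero_of_forall_sub_mul (p := p) (N := N) (B := c.coeff i) (by omega)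
      fun x hx => ?_).1
    obtain ⟨s, -, hs, -⟩ := (hrel x hx).exists_coeff ha hc hω
    rw [hs i hi (by omega), hW i (by omega) hip, hW (i - 1) (by omega) (by omega)]
    ring
  have hS : ∀ x ∈ N, ∃ s : F, s ≠ 0 ∧ ε' - x ^ p ^ 2 * ε = - (s * x * κ) ∧
      a.coeff 0 + x ^ p * a.coeff p - x ^ p ^ 2 * (c.coeff 0 + x ^ p * c.coeff p) =
        s * (-(x * ω.coeff 0) + x ^ p * (κ - x * ω.coeff p)) ∧
      a.coeff 1 + x ^ p * a.coeff (p + 1) - x ^ p ^ 2 * (c.coeff 1 + x ^ p * c.coeff (p + 1)) =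
        s * (ω.coeff 0 + x ^ p * ω.coeff p) := fun x hx => by
    obtain ⟨s, hs, h1, h2, h3⟩ := (hrel x hx).exists_coeff ha hc hω
    refine ⟨s, hs, ?_, h2, ?_⟩
    · rw [h1 (p - 1) (by omega) (by omega), hW (p - 1 - 1) (by omega) (by omega)]
      ring
    · rw [h3, hW 1 le_rfl (by omega)]
      ring
  obtain ⟨A₁, hA₁⟩ : ∃ t, t = κ * a.coeff 0 - ε' * ω.coeff 0 := ⟨_, rfl⟩
  obtain ⟨A₃, hA₃⟩ : ∃ t, t = κ * a.coeff p - ε' * ω.coeff p := ⟨_, rfl⟩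
  obtain ⟨C₁, hC₁⟩ : ∃ t, t = κ * c.coeff 0 - ε * ω.coeff 0 := ⟨_, rfl⟩
  obtain ⟨C₃, hC₃⟩ : ∃ t, t = κ * c.coeff p - ε * ω.coeff p := ⟨_, rfl⟩
  have hz : ∀ x ∈ N, x ^ p ^ 2 * (C₁ * x + C₃ * x * x ^ p + ε * κ * x ^ p) =
      A₁ * x + A₃ * x * x ^ p + ε' * κ * x ^ p := fun x hx => by
    obtain ⟨s, -, h1, h2, -⟩ := hS x hx
    rw [hA₁, hA₃, hC₁, hC₃]
    linear_combination -(κ * x) * h2 +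
      (x * ω.coeff 0 - x ^ p * κ + x * x ^ p * ω.coeff p) * h1
  obtain ⟨⟨-, -, e20⟩, ⟨e01, -, e21⟩, -⟩ := biquadratic_eq_zero hp3 (N := N) hN
    (e₀₀ := 0) (e₁₀ := - A₁ * (ε' * κ) ^ p) (e₂₀ := A₁ * (ε * κ) ^ p)
    (e₀₁ := - (ε' * κ) * (ε' * κ) ^ p)
    (e₁₁ := - A₁ * A₃ ^ p - A₃ * (ε' * κ) ^ p + ε' * κ * (ε * κ) ^ p - C₁ * A₁ ^ p)
    (e₂₁ := A₁ * C₃ ^ p + A₃ * (ε * κ) ^ p + C₁ * C₁ ^ p)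
    (e₀₂ := - (ε' * κ) * A₃ ^ p - ε * κ * A₁ ^ p)
    (e₁₂ := - A₃ * A₃ ^ p + ε' * κ * C₃ ^ p - C₃ * A₁ ^ p + ε * κ * C₁ ^ p)
    (e₂₂ := A₃ * C₃ ^ p + C₃ * C₁ ^ p)
    (fun x hx => by
      have h1 := hz x hx
      have h2 := congrArg (· ^ p) h1
      simp only [add_pow_char, mul_pow, pow_pow_sq hq, hp2] at h2
      simp only [mul_pow]
      linear_combination -(C₃ ^ p * x * x ^ p + ε ^ p * κ ^ p * x - A₃ ^ p * x ^ p -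
        ε' ^ p * κ ^ p) * h1 + (C₁ * x + C₃ * x * x ^ p + ε * κ * x ^ p) * h2)
  have hε' : ε' = 0 := by
    rw [neg_mul, neg_eq_zero, ← pow_succ', pow_eq_zero_iff (by omega)] at e01
    exact (mul_eq_zero.1 e01).resolve_right hκ
  have hx0 : ∀ x ∈ N, x ≠ 0 := fun x hx h => hN0 (h ▸ hx)
  have hε : ε ≠ 0 := fun h0 => by
    obtain ⟨x, hx⟩ := Finset.card_pos.1 (by omega : 0 < N.card)
    obtain ⟨s, hs, h1, -⟩ := hS x hx
    rw [hε', h0, mul_zero, sub_zero, zero_eq_neg] at h1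
    exact mul_ne_zero (mul_ne_zero hs (hx0 x hx)) hκ h1
  have hg := mul_ne_zero hε hκ
  have hA₁0 := (mul_eq_zero.1 e20).resolve_right (pow_ne_zero _ hg)
  have a0 : a.coeff 0 = 0 := by
    rw [hA₁, hε', zero_mul, sub_zero] at hA₁0
    exact (mul_eq_zero.1 hA₁0).resolve_left hκ
  have hz' : ∀ x ∈ N, x ^ p ^ 2 * (C₁ * x + C₃ * x * x ^ p + ε * κ * x ^ p) =
      A₃ * x * x ^ p := fun x hx => by
    rw [hz x hx, hA₁0, hε']; ring
  have hC₁0 : C₁ ≠ 0 := fun h0 => by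
    rw [hA₁0, h0, zero_mul, zero_mul, zero_add, add_zero] at e21
    have hA₃0 := (mul_eq_zero.1 e21).resolve_right (pow_ne_zero _ hg)
    have h1 : ∀ x ∈ N, C₃ * x = - (ε * κ) := fun x hx => by
      have h2 := hz' x hx
      rw [h0, hA₃0] at h2
      have h3 : x ^ p ^ 2 * x ^ p * (C₃ * x + ε * κ) = 0 := by linear_combination h2
      have h4 := hx0 x hx
      exact eq_neg_of_add_eq_zero_left ((mul_eq_zero.1 h3).resolve_left
        (mul_ne_zero (pow_ne_zero _ h4) (pow_ne_zero _ h4)))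
    obtain ⟨x, hx, y, hy, hxy⟩ := Finset.one_lt_card.1 (by omega : 1 < N.card)
    have h2 : C₃ ≠ 0 := fun h3 => by
      have h4 := h1 x hx
      rw [h3, zero_mul, zero_eq_neg] at h4
      exact hg h4
    exact hxy (mul_left_cancel₀ h2 ((h1 x hx).trans (h1 y hy).symm))
  obtain ⟨⟨-, e10, -⟩, -⟩ := biquadratic_eq_zero hp3 (N := N) hN
    (e₀₀ := 0) (e₁₀ := κ * a.coeff 1 * C₁) (e₂₀ := 0)
    (e₀₁ := κ * a.coeff 1 * (ε * κ) - A₃ * ε * ω.coeff 0)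
    (e₁₁ := κ * a.coeff 1 * C₃ + κ * a.coeff (p + 1) * C₁ - A₃ * κ * c.coeff 1) (e₂₁ := 0)
    (e₀₂ := κ * a.coeff (p + 1) * (ε * κ) - A₃ * ε * ω.coeff p)
    (e₁₂ := κ * a.coeff (p + 1) * C₃ - A₃ * κ * c.coeff (p + 1)) (e₂₂ := 0)
    (fun x hx => by
      obtain ⟨s, -, h1, -, h2⟩ := hS x hx
      have h3 := hz' x hx
      rw [hε'] at h1
      refine (mul_eq_zero.1 (?_ : x * _ = 0)).resolve_left (hx0 x hx)
      linear_combination (κ * x * h2 + (ω.coeff 0 + x ^ p * ω.coeff p) * h1) *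
        (C₁ * x + C₃ * x * x ^ p + ε * κ * x ^ p) +
        (κ * x * (c.coeff 1 + x ^ p * c.coeff (p + 1)) +
          ε * (ω.coeff 0 + x ^ p * ω.coeff p)) * h3)
  have a1 : a.coeff 1 = 0 := by
    have := (mul_eq_zero.1 e10).resolve_right hC₁0
    exact (mul_eq_zero.1 this).resolve_left hκ
  refine ⟨X_pow_dvd_iff.2 fun i hi => ?_, ?_⟩
  · by_cases h0 : i = 0
    · rw [h0, a0]
    · by_cases h1 : i = 1
      · rw [h1, a1]
      · by_cases h2 : i = p - 1
        · rw [h2]; exact hε'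
        · exact hmid i (by omega) (by omega)
  · by_contra! hcard
    set R : F[X] := C C₁ * X ^ (p ^ 2 - p) + C C₃ * X ^ p ^ 2 + C (ε * κ) * X ^ (p ^ 2 - 1) - C A₃
      with hR
    have hpp : p + 2 ≤ p ^ 2 := by nlinarith
    have hR0 : R = 0 := by
      refine eq_zero_of_natDegree_lt_card_of_eval_eq_zero' R N (fun x hx => ?_)
        (lt_of_le_of_lt ?_ hcard)
      · refine (mul_eq_zero.1 (?_ : x ^ (p + 1) * _ = 0)).resolve_left (pow_ne_zero _ (hx0 x hx))
        rw [hR]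
        simp only [eval_sub, eval_add, eval_mul, eval_C, eval_X, eval_pow]
        have e1 : x ^ (p + 1) * x ^ (p ^ 2 - p) = x ^ p ^ 2 * x := by
          rw [← pow_add, ← pow_succ]; congr 1; omega
        have e2 : x ^ (p + 1) * x ^ (p ^ 2 - 1) = x ^ p ^ 2 * x ^ p := by
          rw [← pow_add, ← pow_add]; congr 1; omega
        linear_combination C₁ * e1 + ε * κ * e2 + hz' x hx
      · rw [hR]
        refine (natDegree_sub_le _ _).trans (max_le (natDegree_add_le_of_degree_le
          (natDegree_add_le_of_degree_le ?_ ?_) ?_) (by simp)) <;>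
        exact (natDegree_C_mul_X_pow_le _ _).trans (by omega)
    have h1 := congrArg (fun f => coeff f (p ^ 2 - 1)) hR0
    simp only [hR, coeff_sub, coeff_add, coeff_C_mul, coeff_X_pow, coeff_zero, coeff_C] at h1
    rw [if_neg (by omega), if_neg (by omega), if_pos trivial, if_neg (by omega)] at h1
    exact hg (by linear_combination h1)

end DegreePAddOne

section Translation

variable {F : Type*} [Field F] {p : ℕ} [Fact p.Prime] [CharP F p]

lemma SimpleRootRel.translate {a c ω : F[X]} {x : F} (h : SimpleRootRel p a c ω x) (r : F) :
    SimpleRootRel p (a.comp (X + C r) - C (r ^ p ^ 2) * c.comp (X + C r)) (c.comp (X + C r))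
      (ω.comp (X + C r)) (x - r) := by
  obtain ⟨s, hs, Q, hQ⟩ := h
  refine ⟨s, hs, Q.comp (X + C r), ?_⟩
  have h1 := congrArg (fun f => f.comp (X + C r)) hQ
  simp only [sub_comp, mul_comp, pow_comp, X_comp, C_comp] at h1
  rw [sub_pow_char_pow, C_sub, C_sub, sub_sub_eq_add_sub, ← h1]
  ring

lemma X_sub_C_pow_dvd_of_translate {a c : F[X]} {r : F} {k : ℕ} (hk : k ≤ p ^ 2)
    (h : X ^ k ∣ a.comp (X + C r) - C (r ^ p ^ 2) * c.comp (X + C r)) :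
    (X - C r) ^ k ∣ X ^ p ^ 2 * c - a := by
  obtain ⟨Q, hQ⟩ : X ^ k ∣ X ^ p ^ 2 * c.comp (X + C r) -
      (a.comp (X + C r) - C (r ^ p ^ 2) * c.comp (X + C r)) :=
    dvd_sub (Dvd.dvd.mul_right (pow_dvd_pow _ hk) _) h
  refine ⟨Q.comp (X - C r), ?_⟩
  have h1 := congrArg (fun f => f.comp (X - C r)) hQ
  simp only [sub_comp, mul_comp, pow_comp, X_comp, C_comp, comp_assoc, add_comp, sub_add_cancel,
    comp_X] at h1
  rw [← h1, sub_pow_char_pow, C_pow]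
  ring

lemma coeff_comp_X_add_C_of_recurrence {ω : F[X]} (hω : ω.natDegree ≤ p) {r : F}
    (h : ∀ i, 2 ≤ i → i < p → 1 * ω.coeff (i - 1) + -r * ω.coeff i = 0) (hp3 : 3 ≤ p) :
    (∀ i, 1 ≤ i → i < p - 1 → (ω.comp (X + C r)).coeff i = 0) ∧
      (ω.comp (X + C r)).coeff (p - 1) = ω.coeff (p - 1) := by
  have h1 := congrArg (fun f => f.comp (X + C r)) (linear_mul_eq_four_terms hω h)
  simp only [add_comp, mul_comp, pow_comp, X_comp, C_comp, pow_succ (X + C r), add_pow_char,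
    ← C_pow] at h1
  have h2 : X * ω.comp (X + C r) =
      C (-r * ω.coeff 0 + (1 * ω.coeff 0 + -r * ω.coeff 1) * r +
        (1 * ω.coeff (p - 1) + -r * ω.coeff p) * r ^ p + 1 * ω.coeff p * r ^ p * r) +
      C ((1 * ω.coeff 0 + -r * ω.coeff 1) + 1 * ω.coeff p * r ^ p) * X +
      C (ω.coeff (p - 1)) * X ^ p + C (ω.coeff p) * X ^ (p + 1) := by
    rw [show X * ω.comp (X + C r) = (C 1 * (X + C r) + C (-r)) * ω.comp (X + C r) by
      simp only [C_neg, C_1]; ring, h1]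
    simp only [C_add, C_mul, C_neg, C_1, C_pow]
    ring
  have h3 : ∀ i, 1 ≤ i → i < p → (ω.comp (X + C r)).coeff i =
      if i + 1 = p then ω.coeff (p - 1) else 0 := fun i hi hip => by
    rw [← coeff_X_mul, h2]
    simp only [coeff_add, coeff_C_mul, coeff_X_pow, coeff_X, coeff_C_succ]
    rw [if_neg (by omega : ¬ 1 = i + 1), if_neg (by omega : ¬ i + 1 = p + 1)]
    simp
  refine ⟨fun i hi hip => ?_, ?_⟩
  · rw [h3 i hi (by omega), if_neg (by omega)]
  · rw [h3 _ (by omega) (by omega), if_pos (by omega)]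

variable [Fintype F] [DecidableEq F]

lemma pow_dvd_of_degree_eq_prime_add_one (hq : Fintype.card F = p ^ 3) (hp3 : 3 ≤ p)
    {a c ω : F[X]} (ha : a.natDegree ≤ p + 1) (hc : c.natDegree ≤ p + 1) (hω : ω.natDegree ≤ p)
    {N N₁ : Finset F} (hN : 2 * p + 2 < N.card) (hN₁ : 2 * p + 4 ≤ N₁.card)
    (hroot : ∀ x ∈ N, (X ^ p ^ 2 * c - a).eval x = 0)
    (hrel : ∀ x ∈ N₁, SimpleRootRel p a c ω x) (h0 : X ^ 2 ∣ a) (hcd : c.coeff (p + 1) ≠ 0) :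
    X ^ (p + 1) ∣ a ∨
      ∃ r, (X - C r) ^ p ∣ X ^ p ^ 2 * c - a ∧ (N₁.erase r).card ≤ p ^ 2 := by
  by_cases hW0 : ∀ i, 1 ≤ i → i < p → ω.coeff i = 0
  · exact Or.inl (X_pow_dvd_of_coeff_eq_zero hq hp3 ha hc hω hN (by omega) hroot hrel h0 hW0)
  right
  obtain ⟨α, β, hαβ, hW⟩ := exists_linear_relation (I := Finset.Ico 2 p)
    (W := fun i => ω.coeff (i - 1)) (W' := fun i => ω.coeff i) (A := a.coeff) (C := c.coeff) hq
    (N := N₁) (by omega) (fun x hx => by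
      obtain ⟨s, hs, h1, -⟩ := (hrel x hx).exists_coeff ha hc hω
      refine ⟨s, hs, fun i hi => ?_⟩
      rw [Finset.mem_Ico] at hi
      exact h1 i hi.1 hi.2)
  by_cases hα : α = 0
  · have h1 : ∀ i, 2 ≤ i → i < p → ω.coeff i = 0 := fun i hi hip => by
      have h2 := hW i (Finset.mem_Ico.2 ⟨hi, hip⟩)
      rw [hα, zero_mul, zero_add] at h2
      exact (mul_eq_zero.1 h2).resolve_left (hαβ.resolve_left (not_not.2 hα))
    have h2 : ω.coeff 1 ≠ 0 := fun h2 => hW0 fun i hi hip => by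
      rcases eq_or_lt_of_le hi with rfl | h3
      · exact h2
      · exact h1 i h3 hip
    exact absurd (coeff_eq_zero_of_coeff_one_ne_zero hq hp3 ha hc hω (by omega) hrel h1 h2) hcd
  · set r := -β / α with hr
    have hrec : ∀ i, 2 ≤ i → i < p → 1 * ω.coeff (i - 1) + -r * ω.coeff i = 0 :=
      fun i hi hip => by
        have h2 := hW i (Finset.mem_Ico.2 ⟨hi, hip⟩)
        rw [hr]
        field_simp
        linear_combination h2
    have hκ : ω.coeff (p - 1) ≠ 0 := fun hκ => hW0 fun i hi hip => by
      have : ∀ k, k < p - 1 → ω.coeff (p - 1 - k) = 0 := fun k => by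
        induction k with
        | zero => exact fun _ => hκ
        | succ k ih =>
          intro hk
          have h2 := hrec (p - 1 - k) (by omega) (by omega)
          rw [ih (by omega), mul_zero, add_zero, one_mul] at h2
          rwa [Nat.sub_sub] at h2
      have h3 := this (p - 1 - i) (by omega)
      rwa [show p - 1 - (p - 1 - i) = i by omega] at h3
    obtain ⟨h1, h2⟩ := coeff_comp_X_add_C_of_recurrence hω hrec hp3
    have hdeg : ∀ f : F[X], (f.comp (X + C r)).natDegree = f.natDegree := fun f => by
      rw [natDegree_comp, natDegree_X_add_C, mul_one]
    have hcard : ((N₁.erase r).image (· - r)).card = (N₁.erase r).card :=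
      Finset.card_image_of_injective _ sub_left_injective
    have hpred : N₁.card - 1 ≤ (N₁.erase r).card := Finset.pred_card_le_card_erase
    obtain ⟨h3, h4⟩ := X_pow_dvd_of_coeff_pred_ne_zero (p := p) hq hp3
      (a := a.comp (X + C r) - C (r ^ p ^ 2) * c.comp (X + C r)) (c := c.comp (X + C r))
      (ω := ω.comp (X + C r)) (N := (N₁.erase r).image (· - r))
      ((natDegree_sub_le _ _).trans (max_le ((hdeg a).le.trans ha)
        ((natDegree_C_mul_le _ _).trans ((hdeg c).le.trans hc))))
      ((hdeg c).le.trans hc) ((hdeg ω).le.trans hω) (by omega)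
      (fun y hy => by
        obtain ⟨x, hx, rfl⟩ := Finset.mem_image.1 hy
        exact (hrel x (Finset.mem_of_mem_erase hx)).translate r)
      (fun h => by
        obtain ⟨x, hx, h5⟩ := Finset.mem_image.1 h
        exact Finset.ne_of_mem_erase hx (sub_eq_zero.1 h5))
      h1 (h2 ▸ hκ)
    have hp1 : p ≤ p ^ 2 := Nat.le_self_pow two_ne_zero p
    exact ⟨r, X_sub_C_pow_dvd_of_translate hp1 h3, hcard ▸ h4⟩

end Translation

section FramePair

variable {F : Type*} [Field F]

lemma exists_isFrame_pair {t u T : Fin 3 → F} (ht : t ≠ 0) (hT : T ≠ 0) (hTt : T ⬝ᵥ t = 0)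
    (hTu : T ⬝ᵥ u = 0) (hu : ∀ c : F, u ≠ c • t) : ∃ w, T ⬝ᵥ w = 1 ∧ IsFrame t u w := by
  obtain ⟨v, w, hv, hw, hfr⟩ := exists_isFrame ht hT hTt
  refine ⟨w, hw, ?_⟩
  obtain ⟨a, b, c, habc⟩ := hfr.span u
  have hc : c = 0 := by
    have h1 := hTu
    rw [habc] at h1
    simpa [dotProduct_add, hTt, hv, hw] using h1
  rw [hc, zero_smul, add_zero] at habc
  have hb : b ≠ 0 := fun hb => hu a (by rw [habc, hb, zero_smul, add_zero])
  have hvu : v = b⁻¹ • u - (b⁻¹ * a) • t := by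
    rw [habc, smul_add, smul_smul, smul_smul, inv_mul_cancel₀ hb, one_smul, add_sub_cancel_left]
  constructor
  · intro x
    obtain ⟨a', b', c', rfl⟩ := hfr.span x
    refine ⟨a' - b' * (b⁻¹ * a), b' * b⁻¹, c', ?_⟩
    rw [hvu]
    module
  · intro a' b' c' h
    rw [habc] at h
    obtain ⟨h1, h2, h3⟩ := hfr.indep (a' + b' * a) (b' * b) c' (by rw [← h]; module)
    have hb' := (mul_eq_zero.1 h2).resolve_right hb
    rw [hb', zero_mul, add_zero] at h1
    exact ⟨h1, hb', h3⟩

end FramePair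

section Pencil

variable {F : Type*} [Field F] [Fintype F] [DecidableEq F] {ι : Type*} {p : ℕ} [Fact p.Prime]
  [CharP F p] {S : Finset ι} {r : ι → Fin 3 → F}

local notation "q" => Fintype.card F

/-- The pencil of lines through a point of `S`, a tangent line being put at infinity. -/
lemma SmallBlocking.exists_pencil_of_tangent (hB : SmallBlocking S r) (hq : q = p ^ 3) {d : ℕ}
    (hcard : S.card = q + 1 + p * d) {i₀ : ι} (hi₀ : i₀ ∈ S) {t v w : Fin 3 → F}
    (hfr : IsFrame t v w) (ht : r i₀ ⬝ᵥ t = 0) (hv : r i₀ ⬝ᵥ v = 0) (hw : r i₀ ⬝ᵥ w = 1)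
    (ht1 : lineCard S r t = 1) :
    ∃ a c ω : F[X], a.natDegree ≤ d ∧ c.natDegree ≤ d ∧ ω.natDegree ≤ d - 1 ∧
      X ^ p ^ 2 * c - a ≠ 0 ∧ (X ^ p ^ 2 * c - a).Splits ∧
      (X ^ p ^ 2 * c - a).natDegree = p ^ 2 + d ∧
      (∀ m, (X ^ p ^ 2 * c - a).rootMultiplicity m = excess p S r (m • t + v)) ∧
      ∀ m, excess p S r (m • t + v) = 1 → SimpleRootRel p a c ω m := by
  have hp := (Fact.out : p.Prime)
  obtain ⟨-, h2, -⟩ := hB.le_succ hp hq hcard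
  have h3 : 0 < p ^ 3 := pow_pos hp.pos 3
  rw [hq] at hcard
  obtain ⟨a, c, ω, ha, hc, hω, h0, hs, hdeg, hm, hrel⟩ :=
    hB.exists_pencil hq hcard (by omega) hi₀ hfr ht hv hw
  have he : ∀ m, (X ^ p ^ 2 * c - a).rootMultiplicity m = excess p S r (m • t + v) :=
    fun m => (excess_eq hp.pos (hm m)).symm
  refine ⟨a, c, ω, ha, hc, hω, h0, hs, ?_, he, fun m h => hrel m ((he m).trans h)⟩
  refine Nat.eq_of_mul_eq_mul_left hp.pos ?_
  rw [ht1, hcard] at hdeg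
  rw [mul_add, show p * p ^ 2 = p ^ 3 by ring]
  omega

lemma SmallBlocking.prime_le (hB : SmallBlocking S r) (hq : q = p ^ 3) {d : ℕ}
    (hcard : S.card = q + 1 + p * d) : p ≤ d := by
  have hp := (Fact.out : p.Prime)
  obtain ⟨i, hi⟩ : S.Nonempty := Finset.card_pos.1 (by omega)
  obtain ⟨t, ht, hit, htan⟩ := hB.tangent i hi
  obtain ⟨v, w, hv, hw, hfr⟩ := exists_isFrame ht (hB.ne_zero i hi) hit
  have ht1 : lineCard S r t = 1 := lineCard_eq_one hi hit htan
  obtain ⟨a, c, ω, ha, hc, -, -, hs, hdeg, hm, -⟩ :=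
    hB.exists_pencil_of_tangent hq hcard hi hfr hit hv hw ht1
  refine prime_le_of_pencil hq ha hc hs hdeg fun m => ?_
  rw [hm]
  refine hB.excess_le hp.pos hcard fun h0 => ?_
  exact one_ne_zero (hfr.indep m 1 0 (by simpa using h0)).2.1

lemma excess_smul {b : F} (hb : b ≠ 0) (u : Fin 3 → F) :
    excess p S r (b • u) = excess p S r u := by
  simp only [excess, lineCard, dotProduct_smul, smul_eq_mul, mul_eq_zero, hb, false_or]

/-- Averaging over the points of a line: one of them lies on few other lines of large excess. -/
lemma SmallBlocking.exists_point (hB : SmallBlocking S r) {W : ℕ}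
    (hW : ∑ u ∈ Finset.univ.erase (0 : Fin 3 → F), excess p S r u * (excess p S r u - 1) =
      (q - 1) * W) {u : Fin 3 → F} (hu : u ≠ 0) (he : 1 ≤ excess p S r u) :
    ∃ i ∈ S, ∃ t w, IsFrame t u w ∧ r i ⬝ᵥ t = 0 ∧ r i ⬝ᵥ u = 0 ∧ r i ⬝ᵥ w = 1 ∧
      lineCard S r t = 1 ∧
      (1 + p * excess p S r u) * ∑ m ∈ Finset.univ.erase (0 : F),
        excess p S r (m • t + u) * (excess p S r (m • t + u) - 1) +
        excess p S r u * (excess p S r u - 1) ≤ W := by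
  classical
  have hp := (Fact.out : p.Prime)
  set g : (Fin 3 → F) → ℕ := fun v => excess p S r v * (excess p S r v - 1) with hg
  set L := S.filter fun i => r i ⬝ᵥ u = 0 with hL
  have hLcard : L.card = 1 + p * excess p S r u := hB.lineCard_eq hu
  have hLne : L.Nonempty := Finset.card_pos.1 (by omega)
  choose! t ht hit htan using hB.tangent
  have hLS : ∀ i ∈ L, i ∈ S ∧ r i ⬝ᵥ u = 0 := fun i hi => Finset.mem_filter.1 hi
  have ht1 : ∀ i ∈ S, lineCard S r (t i) = 1 := fun i hi =>
    lineCard_eq_one hi (hit i hi) (htan i hi)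
  have hframe : ∀ i ∈ L, ∃ w, r i ⬝ᵥ w = 1 ∧ IsFrame (t i) u w := fun i hi => by
    obtain ⟨hiS, hiu⟩ := hLS i hi
    refine exists_isFrame_pair (ht i hiS) (hB.ne_zero i hiS) (hit i hiS) hiu fun c hc => ?_
    have hc0 : c ≠ 0 := fun h0 => hu (by rw [hc, h0, zero_smul])
    have h1 : excess p S r u = 0 := by
      rw [hc, excess_smul hc0]
      exact excess_eq hp.pos (by rw [ht1 i hiS, mul_zero, add_zero])
    omega
  have hE : ∀ x : F, x ∈ Finset.univ.erase (0 : F) ↔ x ≠ 0 := fun x => by simp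
  have hsum : (q - 1) * ∑ i ∈ L, ∑ m ∈ Finset.univ.erase (0 : F), g (m • t i + u) +
      (q - 1) * g u ≤ (q - 1) * W := by
    set A := (Finset.univ.erase (0 : F)).image fun b => b • u
    set D := L ×ˢ (Finset.univ.erase (0 : F)) ×ˢ (Finset.univ.erase (0 : F))
    set f : ι × F × F → Fin 3 → F := fun x => x.2.1 • (x.2.2 • t x.1 + u) with hf
    have hinj : Set.InjOn f D := by
      rintro ⟨i, b, m⟩ hx ⟨i', b', m'⟩ hx' h
      simp only [D, Finset.coe_product, Set.mem_prod, Finset.mem_coe, hE] at hx hx'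
      simp only [hf] at h
      obtain ⟨hiS, hiu⟩ := hLS i hx.1
      have hii : i = i' := by
        obtain ⟨hiS', hiu'⟩ := hLS i' hx'.1
        have h1 := congrArg (r i ⬝ᵥ ·) h
        simp only [dotProduct_smul, dotProduct_add, hit i hiS, hiu, add_zero, mul_zero,
          smul_eq_mul] at h1
        have h2 := (mul_eq_zero.1 ((mul_eq_zero.1 h1.symm).resolve_left hx'.2.1)).resolve_left
          hx'.2.2
        exact htan i' hiS' i hiS h2
      subst hii
      obtain ⟨w, -, hfr⟩ := hframe i hx.1
      obtain ⟨h1, h2, -⟩ := hfr.indep (b * m - b' * m') (b - b') 0 (by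
        rw [← sub_eq_zero] at h
        rw [← h]; module)
      have h3 := sub_eq_zero.1 h2
      subst h3
      rw [mul_left_cancel₀ hx.2.1 (sub_eq_zero.1 h1)]
    have hdisj : Disjoint A (D.image f) := by
      rw [Finset.disjoint_left]
      intro v hv hv'
      obtain ⟨b', -, rfl⟩ := Finset.mem_image.1 hv
      obtain ⟨⟨i, b, m⟩, hx, h⟩ := Finset.mem_image.1 hv'
      simp only [D, Finset.mem_product, hE] at hx
      obtain ⟨w, -, hfr⟩ := hframe i hx.1
      obtain ⟨h1, -⟩ := hfr.indep (b * m) (b - b') 0 (by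
        rw [← sub_eq_zero] at h
        rw [← h]; simp only [hf]; module)
      exact mul_ne_zero hx.2.1 hx.2.2 h1
    have hsub : A ∪ D.image f ⊆ Finset.univ.erase 0 := by
      intro v hv
      rw [Finset.mem_erase]
      refine ⟨?_, Finset.mem_univ _⟩
      rcases Finset.mem_union.1 hv with hv | hv
      · obtain ⟨b, hb, rfl⟩ := Finset.mem_image.1 hv
        exact smul_ne_zero ((hE b).1 hb) hu
      · obtain ⟨⟨i, b, m⟩, hx, rfl⟩ := Finset.mem_image.1 hv
        simp only [D, Finset.mem_product, hE] at hx
        refine smul_ne_zero hx.2.1 fun h => ?_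
        obtain ⟨w, -, hfr⟩ := hframe i hx.1
        exact one_ne_zero (hfr.indep m 1 0 (by rw [← h]; module)).2.1
    have hcardE : (Finset.univ.erase (0 : F)).card = q - 1 := by
      rw [Finset.card_erase_of_mem (Finset.mem_univ _), Finset.card_univ]
    have hsA : ∑ v ∈ A, g v = (q - 1) * g u := by
      rw [Finset.sum_image fun x _ y _ h => smul_left_injective F hu h, ← hcardE,
        ← smul_eq_mul, ← Finset.sum_const]
      refine Finset.sum_congr rfl fun b hb => ?_
      simp only [hg, excess_smul ((hE b).1 hb)]
    have hsD : ∑ v ∈ D.image f, g v =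
        (q - 1) * ∑ i ∈ L, ∑ m ∈ Finset.univ.erase (0 : F), g (m • t i + u) := by
      rw [Finset.sum_image hinj, Finset.sum_product, Finset.mul_sum]
      refine Finset.sum_congr rfl fun i _ => ?_
      rw [Finset.sum_product, ← hcardE, ← smul_eq_mul, ← Finset.sum_const]
      refine Finset.sum_congr rfl fun b hb => Finset.sum_congr rfl fun m _ => ?_
      simp only [hg, hf, excess_smul ((hE b).1 hb)]
    rw [← hW, add_comm, ← hsA, ← hsD, ← Finset.sum_union hdisj]
    exact Finset.sum_le_sum_of_subset hsub
  have hq1 : 0 < q - 1 := by have := Fintype.one_lt_card (α := F); omega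
  rw [← mul_add] at hsum
  have hsum' := Nat.le_of_mul_le_mul_left hsum hq1
  obtain ⟨i, hi, hle⟩ := Finset.exists_le_of_sum_le hLne
    (f := fun i => L.card * ∑ m ∈ Finset.univ.erase (0 : F), g (m • t i + u))
    (g := fun _ => W - g u) (by
      rw [← Finset.mul_sum, Finset.sum_const, smul_eq_mul]
      exact Nat.mul_le_mul_left _ (by omega))
  obtain ⟨hiS, hiu⟩ := hLS i hi
  obtain ⟨w, hw, hfr⟩ := hframe i hi
  refine ⟨i, hiS, t i, w, hfr, hit i hiS, hiu, hw, ht1 i hiS, ?_⟩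
  rw [← hLcard]
  have h1 : g u ≤ W := by omega
  have h2 := Nat.add_le_of_le_sub h1 hle
  exact h2

end Pencil

section Redei

variable {F : Type*} [Field F] [Fintype F] [DecidableEq F] {p : ℕ} [Fact p.Prime] [CharP F p]

lemma sum_rootMultiplicity {φ : F[X]} (h : φ.Splits) :
    ∑ m, φ.rootMultiplicity m = φ.natDegree := by
  rw [h.natDegree_eq_card_roots, ← Multiset.sum_count_eq_card (s := Finset.univ)
    (fun _ _ => Finset.mem_univ _)]
  simp only [count_roots]

lemma sum_erase_le (e : F → ℕ) : ∑ m ∈ Finset.univ.erase (0 : F), e m ≤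
    ((Finset.univ.filter fun m => e m = 1).erase 0).card +
      ∑ m ∈ Finset.univ.erase (0 : F), e m * (e m - 1) := by
  have h1 : ((Finset.univ.filter fun m => e m = 1).erase 0).card =
      ∑ m ∈ Finset.univ.erase (0 : F), if e m = 1 then 1 else 0 := by
    rw [← Finset.card_filter, Finset.filter_erase]
  rw [h1, ← Finset.sum_add_distrib]
  refine Finset.sum_le_sum fun m _ => ?_
  split_ifs with h
  · omega
  · rcases Nat.lt_or_ge (e m) 2 with h2 | h2
    · omega
    · have : e m * 1 ≤ e m * (e m - 1) := Nat.mul_le_mul_left _ (by omega)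
      omega

lemma two_mul_sum_erase_le (e : F → ℕ) : 2 * ∑ m ∈ Finset.univ.erase (0 : F), e m ≤
    2 * ((Finset.univ.filter fun m => 1 ≤ e m).erase 0).card +
      ∑ m ∈ Finset.univ.erase (0 : F), e m * (e m - 1) := by
  have h1 : ((Finset.univ.filter fun m => 1 ≤ e m).erase 0).card =
      ∑ m ∈ Finset.univ.erase (0 : F), if 1 ≤ e m then 1 else 0 := by
    rw [← Finset.card_filter, Finset.filter_erase]
  rw [h1, Finset.mul_sum, Finset.mul_sum, ← Finset.sum_add_distrib]
  refine Finset.sum_le_sum fun m _ => ?_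
  split_ifs with h
  · obtain ⟨k, hk⟩ := Nat.exists_eq_add_of_le h
    rw [hk, Nat.add_sub_cancel_left]
    nlinarith [Nat.le_mul_self k]
  · omega

lemma excess_bounds {n k O : ℕ} (hn : 3 ≤ n) (hk : k + 2 ≤ n)
    (h : (1 + n * (k + 2)) * O + (k + 2) * (k + 1) ≤ n ^ 2 + n) :
    k + 2 + O ≤ n ^ 2 - n - 3 ∧ (k + 2 = n → O = 0) ∧ O < n * (n - 1) := by
  obtain ⟨s, rfl⟩ := Nat.exists_eq_add_of_le hn
  have e1 : (3 + s) ^ 2 = s ^ 2 + 6 * s + 9 := by ring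
  have e2 : (3 + s) * (3 + s - 1) = s ^ 2 + 5 * s + 6 := by
    rw [show 3 + s - 1 = s + 2 by omega]; ring
  have h1 : 2 * O ≤ s + 4 := by
    by_contra! h2
    have h3 : (3 + s) * 2 * O ≤ (1 + (3 + s) * (k + 2)) * O :=
      Nat.mul_le_mul_right _ (by nlinarith [Nat.zero_le ((3 + s) * k)])
    have h4 : (3 + s) * (s + 5) ≤ (3 + s) * (2 * O) := Nat.mul_le_mul_left _ h2
    have h5 : (3 + s) * 2 * O = (3 + s) * (2 * O) := by ring
    have h6 : (3 + s) * (s + 5) = s ^ 2 + 8 * s + 15 := by ring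
    have h7 := Nat.zero_le ((k + 2) * (k + 1))
    omega
  refine ⟨?_, fun h3 => ?_, ?_⟩
  · rw [e1, show s ^ 2 + 6 * s + 9 - (3 + s) - 3 = s ^ 2 + 5 * s + 3 by omega]
    rcases Nat.eq_zero_or_pos s with rfl | hs
    · have : k ≤ 1 := by omega
      interval_cases k <;> omega
    · omega
  · rcases Nat.eq_zero_or_pos O with h4 | h4
    · exact h4
    · obtain rfl : k = s + 1 := by omega
      have h5 : (1 + (3 + s) * (s + 1 + 2)) * 1 ≤ (1 + (3 + s) * (s + 1 + 2)) * O :=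
        Nat.mul_le_mul_left _ h4
      have h6 : (3 + s) * (s + 1 + 2) = s ^ 2 + 6 * s + 9 := by ring
      have h7 : (s + 1 + 2) * (s + 1 + 1) = s ^ 2 + 5 * s + 6 := by ring
      rw [h6] at h h5
      have h8 := Nat.zero_le (s ^ 2)
      omega
  · rw [e2]
    have := Nat.zero_le (s ^ 2)
    omega

variable {ι : Type*} {S : Finset ι} {r : ι → Fin 3 → F}

local notation "q" => Fintype.card F

lemma SmallBlocking.exists_excess_eq_of_two_le (hB : SmallBlocking S r) (hp3 : 3 ≤ p)
    (hq : q = p ^ 3) {d W : ℕ} (hcard : S.card = q + 1 + p * d)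
    (hd : d = p ∧ W = p ^ 3 - p ∨ d = p + 1 ∧ W = p ^ 2 + p)
    (hW : ∑ u ∈ Finset.univ.erase (0 : Fin 3 → F), excess p S r u * (excess p S r u - 1) =
      (q - 1) * W) {u : Fin 3 → F} (hu : u ≠ 0) (he : 2 ≤ excess p S r u) :
    excess p S r u = d := by
  have hp := (Fact.out : p.Prime)
  refine le_antisymm (hB.excess_le hp.pos hcard hu) ?_
  by_contra! hlt
  obtain ⟨i, hi, t, w, hfr, hit, hiu, hiw, ht1, hO⟩ := hB.exists_point hW hu (by omega)
  obtain ⟨a, c, ω, ha, hc, hω, h0, hs, hdeg, hm, hrel⟩ :=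
    hB.exists_pencil_of_tangent hq hcard hi hfr hit hiu hiw ht1
  obtain ⟨e, he_def⟩ : ∃ e : F → ℕ, ∀ m, e m = excess p S r (m • t + u) := ⟨_, fun _ => rfl⟩
  simp only [← he_def] at hO hm hrel
  have he0 : e 0 = excess p S r u := by rw [he_def, zero_smul, zero_add]
  rw [← he0] at he hlt hO
  have hsum : ∑ m, e m = p ^ 2 + d := by
    rw [← hdeg, ← sum_rootMultiplicity hs]
    exact (Finset.sum_congr rfl fun m _ => hm m).symm
  rw [← Finset.add_sum_erase _ _ (Finset.mem_univ 0)] at hsum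
  have h1 := sum_erase_le e
  have h2 := two_mul_sum_erase_le e
  set O := ∑ m ∈ Finset.univ.erase (0 : F), e m * (e m - 1) with hOdef
  set N := Finset.univ.filter fun m => 1 ≤ e m with hN
  set N₁ := Finset.univ.filter fun m => e m = 1 with hN₁
  have h0N₁ : N₁.erase 0 = N₁ := Finset.erase_eq_of_notMem (by simp [hN₁]; omega)
  have h0N : (N.erase 0).card + 1 = N.card :=
    Finset.card_erase_add_one (by simp [hN]; omega)
  rw [h0N₁] at h1
  have hroot : ∀ x ∈ N, (X ^ p ^ 2 * c - a).eval x = 0 := fun x hx =>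
    (rootMultiplicity_pos h0).1 (by rw [hm]; exact (Finset.mem_filter.1 hx).2)
  have hrel' : ∀ x ∈ N₁, SimpleRootRel p a c ω x := fun x hx =>
    hrel x (Finset.mem_filter.1 hx).2
  have hp2 : 2 ≤ p ^ 2 := by nlinarith
  have hXa : X ^ 2 ∣ a := by
    have h3 : (X - C 0) ^ 2 ∣ X ^ p ^ 2 * c - a :=
      (le_rootMultiplicity_iff h0).1 (by rw [hm]; exact he)
    rw [C_0, sub_zero] at h3
    exact (dvd_sub_right ((pow_dvd_pow X hp2).mul_right c)).1 h3
  have hdvd : ∀ k, k ≤ p ^ 2 → X ^ k ∣ a → k ≤ e 0 := fun k hk h3 => by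
    rw [← hm, le_rootMultiplicity_iff h0, C_0, sub_zero]
    exact dvd_sub ((pow_dvd_pow X hk).mul_right c) h3
  have hpp : 3 * p ≤ p ^ 2 := by rw [pow_two]; exact Nat.mul_le_mul_right _ hp3
  obtain ⟨k, hk⟩ : ∃ k, e 0 = k + 2 := ⟨e 0 - 2, by omega⟩
  rw [hk, show k + 2 - 1 = k + 1 by omega] at hO
  rcases hd with ⟨rfl, rfl⟩ | ⟨rfl, rfl⟩
  · have hO2 : 2 * O < d ^ 2 := by
      by_contra! h3
      have h4 : d ^ 3 - d < d ^ 3 := Nat.sub_lt (pow_pos hp.pos 3) hp.pos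
      have h5 : d * (2 * O) ≤ (1 + d * (k + 2)) * O := by nlinarith [Nat.zero_le (d * k * O)]
      have h6 : d * d ^ 2 ≤ d * (2 * O) := Nat.mul_le_mul_left _ h3
      have h7 : d * d ^ 2 = d ^ 3 := by ring
      have h8 := Nat.zero_le ((k + 2) * (k + 1))
      omega
    have h3 : 8 * d ≤ 3 * d ^ 2 + 5 - 8 := by
      refine Nat.le_sub_of_add_le ?_
      zify
      have : (3 : ℤ) ≤ d := by exact_mod_cast hp3
      nlinarith
    have h4 : d ≤ d ^ 2 := by omega
    have := hdvd d h4 (X_pow_dvd_of_degree_eq_prime hq hp3 ha hc hω (N := N) (N₁ := N₁)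
      (by omega) (by omega) hroot hrel' hXa)
    omega
  · have hOk : k + 2 + O ≤ p ^ 2 - p - 3 ∧ (k + 2 = p → O = 0) ∧ O < p * (p - 1) :=
      excess_bounds hp3 (by omega) hO
    obtain ⟨hO1, hO2, hO3⟩ := hOk
    have hcd : c.coeff (p + 1) ≠ 0 := fun h3 => by
      have h4 : (X ^ p ^ 2 * c - a).coeff (p + 1 + p ^ 2) = 0 := by
        rw [coeff_sub, coeff_X_pow_mul, h3, coeff_eq_zero_of_natDegree_lt (by omega), sub_zero]
      rw [add_comm, ← hdeg, coeff_natDegree, leadingCoeff_eq_zero] at h4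
      exact h0 h4
    have hNN : N₁.card ≤ N.card := Finset.card_le_card fun m hm => by
      rw [hN₁, Finset.mem_filter] at hm
      rw [hN, Finset.mem_filter]
      exact ⟨hm.1, hm.2.ge⟩
    rcases pow_dvd_of_degree_eq_prime_add_one hq hp3 ha hc hω (N := N) (N₁ := N₁) (by omega)
      (by omega) hroot hrel' hXa hcd with h3 | ⟨x, hx, hxcard⟩
    · have := hdvd (p + 1) (by omega) h3
      omega
    · rw [← le_rootMultiplicity_iff h0, hm] at hx
      by_cases hx0 : x = 0
      · subst hx0
        rw [h0N₁] at hxcard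
        have := hO2 (by omega)
        omega
      · have h3 : e x * (e x - 1) ≤ O := Finset.single_le_sum (f := fun m => e m * (e m - 1))
          (fun _ _ => Nat.zero_le _) (Finset.mem_erase.2 ⟨hx0, Finset.mem_univ _⟩)
        have h4 : p * (p - 1) ≤ e x * (e x - 1) := Nat.mul_le_mul hx (by omega)
        omega

/-- The size of a small minimal blocking set, and the existence of a Rédei line. -/
lemma SmallBlocking.exists_redei (hB : SmallBlocking S r) (hq : q = p ^ 3) :
    ∃ d, (d = p ∨ d = p + 1) ∧ S.card = p ^ 3 + 1 + p * d ∧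
      ∃ u ≠ 0, lineCard S r u + p ^ 3 = S.card := by
  have hp := (Fact.out : p.Prime)
  obtain ⟨d, hcard⟩ := hB.exists_card_eq (p := p)
  have h1 := hB.prime_le hq hcard
  obtain ⟨h2, -, h3⟩ := hB.le_succ hp hq hcard
  have hd : d = p ∨ d = p + 1 := by omega
  refine ⟨d, hd, by rw [hcard, hq], ?_⟩
  obtain ⟨W, hdW, hWpos⟩ : ∃ W, (d = p ∧ W = p ^ 3 - p ∨ d = p + 1 ∧ W = p ^ 2 + p) ∧ 0 < W := by
    have h4 : p < p ^ 3 := lt_self_pow₀ hp.one_lt (by norm_num)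
    rcases hd with h | h
    · exact ⟨_, Or.inl ⟨h, rfl⟩, by omega⟩
    · exact ⟨_, Or.inr ⟨h, rfl⟩, by have := hp.pos; omega⟩
  have hW : ∑ u ∈ Finset.univ.erase (0 : Fin 3 → F), excess p S r u * (excess p S r u - 1) =
      (q - 1) * W := by
    have h4 := hB.sum_excess hp.pos hq hcard
    have h5 : ∀ n : ℕ, ((n * (n - 1) : ℕ) : ℤ) = n * (n - 1) := fun n => by
      cases n <;> simp
    have h6 : (1 : ℕ) ≤ p ^ 3 := pow_pos hp.pos 3
    have h7 : p ≤ p ^ 3 := Nat.le_self_pow (by norm_num) p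
    zify
    simp only [← Nat.cast_mul, h5]
    rw [h4, hq]
    push_cast [h6]
    rcases hdW with ⟨rfl, rfl⟩ | ⟨rfl, rfl⟩
    · push_cast [h7]; ring
    · push_cast; ring
  obtain ⟨u, hu, he⟩ : ∃ u : Fin 3 → F, u ≠ 0 ∧ 2 ≤ excess p S r u := by
    by_contra! h4
    have h5 : 0 < (q - 1) * W := Nat.mul_pos (by have := Fintype.one_lt_card (α := F); omega) hWpos
    rw [← hW] at h5
    refine h5.ne' (Finset.sum_eq_zero fun u hu => ?_)
    have := h4 u (Finset.ne_of_mem_erase hu)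
    interval_cases excess p S r u <;> rfl
  have hed : excess p S r u = d := by
    rcases hp.two_le.eq_or_lt with h4 | h4
    · have := hB.excess_le hp.pos hcard hu
      have := h3 h4.symm
      omega
    · exact hB.exists_excess_eq_of_two_le h4 hq hcard hdW hW hu he
  refine ⟨u, hu, ?_⟩
  rw [hB.lineCard_eq (p := p) hu, hed, hcard, hq]
  ring

end Redei

section Submodules

variable {F : Type*} [Field F]

lemma exists_eq_span_singleton {V : Type*} [AddCommGroup V] [Module F V] {P : Submodule F V}
    (hP : finrank F P = 1) : ∃ v ≠ 0, P = Submodule.span F {v} := by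
  have := Module.finite_of_finrank_eq_succ hP
  obtain ⟨v, hv, hv0⟩ := P.exists_mem_ne_zero_of_ne_bot fun h => by
    rw [h, finrank_bot] at hP; exact zero_ne_one hP
  refine ⟨v, hv0, (Submodule.eq_of_le_of_finrank_eq ?_ ?_).symm⟩
  · rwa [Submodule.span_singleton_le_iff_mem]
  · rw [finrank_span_singleton hv0, hP]

/-- The line of the projective plane with dual coordinates `u`. -/
def lineOf (u : Fin 3 → F) : Submodule F (Fin 3 → F) :=
  LinearMap.ker ((dotProductBilin F F).flip u)

lemma mem_lineOf {u v : Fin 3 → F} : v ∈ lineOf u ↔ v ⬝ᵥ u = 0 := Iff.rfl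

lemma finrank_lineOf {u : Fin 3 → F} (hu : u ≠ 0) : finrank F (lineOf u) = 2 := by
  have h := Module.Dual.finrank_ker_add_one_of_ne_zero
    (f := (dotProductBilin F F).flip u) fun h0 => hu (dotProduct_eq_zero_iff.1 fun v => by
      rw [dotProduct_comm]; exact LinearMap.congr_fun h0 v)
  rw [finrank_fin_fun] at h
  exact Nat.succ_injective h

lemma exists_eq_lineOf {L : Submodule F (Fin 3 → F)} (hL : finrank F L = 2) :
    ∃ u ≠ 0, L = lineOf u := by
  obtain ⟨f, hf0, hf⟩ := L.exists_le_ker_of_lt_top (lt_top_iff_ne_top.2 fun h => by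
    rw [h, finrank_top, finrank_fin_fun] at hL; omega)
  have hfu : ∀ v, f v = v ⬝ᵥ fun i => f (Pi.single i 1) := fun v => by
    rw [LinearMap.pi_apply_eq_sum_univ f v]
    refine Finset.sum_congr rfl fun i _ => ?_
    rw [smul_eq_mul]
    congr 2
    ext j
    simp [Pi.single_apply, eq_comm]
  have hu : (fun i => f (Pi.single i 1)) ≠ 0 := fun h =>
    hf0 (LinearMap.ext fun v => by rw [hfu, h, dotProduct_zero]; rfl)
  refine ⟨_, hu, Submodule.eq_of_le_of_finrank_eq (fun v hv => ?_) ?_⟩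
  · rw [mem_lineOf, ← hfu]
    exact hf hv
  · rw [hL, finrank_lineOf hu]

end Submodules

/-- Polverino: a small minimal blocking set of `PG(2,p³)` has size `p³+p²+1` or
`p³+p²+p+1` and is of Rédei type. -/
theorem small_blocking_sets_cube_order (p : ℕ) (hp : p.Prime)
    (F : Type) [Field F] [Fintype F] (hF : Fintype.card F = p ^ 3)
    (B : Set (Submodule F (Fin 3 → F)))
    (hBpts : ∀ P ∈ B, finrank F P = 1)
    (hblock : ∀ L : Submodule F (Fin 3 → F), finrank F L = 2 → ∃ P ∈ B, P ≤ L)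
    (hmin : ∀ B' ⊂ B, ¬ ∀ L : Submodule F (Fin 3 → F), finrank F L = 2 → ∃ P ∈ B', P ≤ L)
    (hnoline : ∀ L : Submodule F (Fin 3 → F), finrank F L = 2 →
      ∃ P : Submodule F (Fin 3 → F), finrank F P = 1 ∧ P ≤ L ∧ P ∉ B)
    (hsmall : 2 * B.ncard < 3 * (p ^ 3 + 1)) :
    (B.ncard = p ^ 3 + p ^ 2 + 1 ∨ B.ncard = p ^ 3 + p ^ 2 + p + 1) ∧
    ∃ L : Submodule F (Fin 3 → F), finrank F L = 2 ∧
      Set.ncard {P ∈ B | P ≤ L} + p ^ 3 = B.ncard := by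
  classical
  have : Fact p.Prime := ⟨hp⟩
  have : CharP F p := charP_of_card_eq_prime_pow hF
  choose! r hr0 hr using fun P hP => exists_eq_span_singleton (hBpts P hP)
  set S := B.toFinite.toFinset with hS
  have hSB : ∀ P, P ∈ S ↔ P ∈ B := fun P => Set.Finite.mem_toFinset _
  have hcard : B.ncard = S.card := Set.ncard_eq_toFinset_card B
  have hle : ∀ P ∈ B, ∀ u, P ≤ lineOf u ↔ r P ⬝ᵥ u = 0 := fun P hP u => by
    conv_lhs => rw [hr P hP, Submodule.span_singleton_le_iff_mem, mem_lineOf]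
  have hB : SmallBlocking S r :=
    { ne_zero := fun P hP => hr0 P ((hSB P).1 hP)
      eq_of_smul := fun P hP Q hQ c h => by
        rw [hSB] at hP hQ
        refine Submodule.eq_of_le_of_finrank_eq ?_ ((hBpts P hP).trans (hBpts Q hQ).symm)
        rw [hr P hP, Submodule.span_singleton_le_iff_mem, h]
        exact Submodule.smul_mem _ _ ((hr Q hQ).ge (Submodule.mem_span_singleton_self _))
      block := fun u hu => by
        obtain ⟨P, hP, hPu⟩ := hblock _ (finrank_lineOf hu)
        exact ⟨P, (hSB P).2 hP, (hle P hP u).1 hPu⟩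
      tangent := fun P hP => by
        rw [hSB] at hP
        have h1 := hmin (B \ {P}) ⟨Set.sdiff_subset, fun h => (h hP).2 rfl⟩
        push Not at h1
        obtain ⟨L, hL, h2⟩ := h1
        obtain ⟨u, hu, rfl⟩ := exists_eq_lineOf hL
        have h3 : ∀ Q ∈ B, Q ≤ lineOf u → Q = P := fun Q hQ hQu => by
          by_contra hQP
          exact h2 Q ⟨hQ, hQP⟩ hQu
        obtain ⟨Q, hQ, hQu⟩ := hblock _ hL
        refine ⟨u, hu, (hle P hP u).1 (h3 Q hQ hQu ▸ hQu), fun Q hQ hQu => ?_⟩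
        rw [hSB] at hQ
        exact h3 Q hQ ((hle Q hQ u).2 hQu)
      noline := fun u hu => by
        obtain ⟨P, hP1, hPu, hPB⟩ := hnoline _ (finrank_lineOf hu)
        obtain ⟨T, hT, rfl⟩ := exists_eq_span_singleton hP1
        refine ⟨T, hT, mem_lineOf.1 (hPu (Submodule.mem_span_singleton_self T)),
          fun Q hQ c h => hPB ?_⟩
        rw [hSB] at hQ
        rw [← Submodule.eq_of_le_of_finrank_eq (S₁ := Q) ?_ ((hBpts Q hQ).trans hP1.symm)]
        · exact hQ
        · rw [hr Q hQ, Submodule.span_singleton_le_iff_mem, h]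
          exact Submodule.smul_mem _ _ (Submodule.mem_span_singleton_self T)
      small := by rw [← hcard, hF]; exact hsmall }
  obtain ⟨d, hd, hSd, u, hu, hline⟩ := hB.exists_redei hF
  rw [hcard]
  refine ⟨?_, lineOf u, finrank_lineOf hu, ?_⟩
  · rw [hSd]
    rcases hd with rfl | rfl
    · left; ring
    · right; ring
  · rw [← hline]
    congr 1
    rw [lineCard, ← Set.ncard_coe_finset]
    congr 1
    ext P
    simp only [Set.mem_ofPred_eq, Finset.coe_filter, hSB]
    exact and_congr_right fun hP => hle P hP u
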